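/- Let C > 0 be a real number, N ≥ 0 an integer, and n ≥ 1 an integer satisfying exp(−(π/2)√(2n/3)) ≤ C · √(2N+2)/(√(24n))^{2N+1}. Then −(C + (6√2/π^{3/2}) · cosh(π/6) · √(1 − 1/(4N+5))) · √(2N+2)/(√(24n))^{2N+1} < R_{2N+1}(n) < C · √(2N+2)/(√(24n))^{2N+1}. -/

import Mathlib

open Real Finset Filter Topology

noncomputable def c (m : ℕ) : ℝ :=
  ((-1 : ℝ) ^ m / (4 * Real.sqrt 6) ^ m) *
    ∑ k ∈ Finset.range ((m + 1) / 2 + 1),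
      ((m + 1).choose k : ℝ) * ((m + 1 - k : ℕ) : ℝ) / ((m + 1 - 2 * k).factorial : ℝ) *
        (π / 6) ^ ((m : ℤ) - 2 * k)

/-- The number of partitions of `n`, as a real number. -/
noncomputable def p (n : ℕ) : ℝ := (Fintype.card (Nat.Partition n) : ℝ)

/-- The remainder after `N` terms of the asymptotic expansion. -/
noncomputable def R (N n : ℕ) : ℝ :=
  4 * Real.sqrt 3 * (n : ℝ) * Real.exp (-(π * Real.sqrt (2 * n / 3))) * p n -
    ∑ m ∈ Finset.range N, c m / (n : ℝ) ^ ((m : ℝ) / 2)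

namespace PartitionAsymptotics

open PowerSeries in
/-- The power series `∑ X ^ (m k)`. -/
noncomputable def geom (m : ℕ) : PowerSeries ℝ := PowerSeries.mk fun n ↦ if m ∣ n then 1 else 0

open PowerSeries PowerSeries.WithPiTopology in
lemma tsum_X_pow_eq_geom {m : ℕ} (hm : 0 < m) :
    ∑' j : ℕ, (X : PowerSeries ℝ) ^ (m * j) = geom m := by
  have h1 : (1 - (X : PowerSeries ℝ) ^ m) * ∑' j : ℕ, (X : PowerSeries ℝ) ^ (m * j) = 1 := by
    simp_rw [pow_mul]
    apply one_sub_mul_tsum_pow_of_constantCoeff_eq_zero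
    simp [hm.ne']
  have h2 : (1 - (X : PowerSeries ℝ) ^ m) * geom m = 1 := by
    ext n
    rw [sub_mul, one_mul, map_sub, coeff_X_pow_mul', geom, coeff_mk, coeff_one]
    simp only [coeff_mk]
    by_cases hn : m ≤ n
    · have : n ≠ 0 := by omega
      simp [hn, this, Nat.dvd_sub_iff_left hn dvd_rfl]
    · rcases Nat.eq_zero_or_pos n with rfl | h0
      · simp [hm.ne']
      · have : ¬ m ∣ n := fun h ↦ hn (Nat.le_of_dvd h0 h)
        simp [hn, this, h0.ne']
  have h3 : (1 - (X : PowerSeries ℝ) ^ m) ≠ 0 := by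
    intro h
    rw [h, zero_mul] at h2
    exact zero_ne_one h2
  exact mul_left_cancel₀ h3 (h1.trans h2.symm)

/-- The number of partitions of `n` into parts at most `K`. -/
noncomputable def pBounded (K n : ℕ) : ℝ :=
  PowerSeries.coeff n (∏ i ∈ Finset.range K, geom (i + 1))

lemma pBounded_succ (K n : ℕ) :
    pBounded (K + 1) n =
      ∑ ij ∈ Finset.HasAntidiagonal.antidiagonal n,
        pBounded K ij.1 * (if K + 1 ∣ ij.2 then 1 else 0) := by
  rw [pBounded, Finset.prod_range_succ, PowerSeries.coeff_mul]
  simp [geom, pBounded]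

lemma pBounded_nonneg (K n : ℕ) : 0 ≤ pBounded K n := by
  induction K generalizing n with
  | zero => simp only [pBounded, Finset.range_zero, Finset.prod_empty, PowerSeries.coeff_one]
            split_ifs <;> simp
  | succ K ih =>
    rw [pBounded_succ]
    refine Finset.sum_nonneg fun ij _ ↦ mul_nonneg (ih _) ?_
    split_ifs <;> simp

lemma pBounded_le_succ (K n : ℕ) : pBounded K n ≤ pBounded (K + 1) n := by
  rw [pBounded_succ]
  have h := Finset.single_le_sum (f := fun ij : ℕ × ℕ ↦ pBounded K ij.1 *
    (if K + 1 ∣ ij.2 then (1 : ℝ) else 0))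
    (s := Finset.HasAntidiagonal.antidiagonal n) (a := (n, 0))
    (fun ij _ ↦ mul_nonneg (pBounded_nonneg _ _) (by split_ifs <;> simp)) (by simp)
  simpa using h

open PowerSeries.WithPiTopology in
lemma tendsto_pBounded (n : ℕ) : Tendsto (fun K ↦ pBounded K n) atTop (𝓝 (p n)) := by
  have h := Nat.Partition.hasProd_powerSeriesMk_card_restricted ℝ (fun _ ↦ True)
  have h2 := h.tendsto_prod_nat
  rw [PowerSeries.WithPiTopology.tendsto_iff_coeff_tendsto] at h2
  have h3 := h2 n
  simp only [if_true, tsum_X_pow_eq_geom (Nat.succ_pos _)] at h3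
  simpa [pBounded, p, Nat.Partition.restricted] using h3

lemma pBounded_le (K n : ℕ) : pBounded K n ≤ p n :=
  (monotone_nat_of_le_succ (f := fun K ↦ pBounded K n)
    (fun K ↦ pBounded_le_succ K n)).ge_of_tendsto (tendsto_pBounded n) K

lemma hasSum_ite_dvd {m : ℕ} (hm : 0 < m) {q : ℂ} (hq : ‖q‖ < 1) :
    HasSum (fun n : ℕ ↦ (if m ∣ n then (1 : ℂ) else 0) * q ^ n) (1 - q ^ m)⁻¹ := by
  have h1 : HasSum (fun j : ℕ ↦ (q ^ m) ^ j) (1 - q ^ m)⁻¹ :=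
    hasSum_geometric_of_norm_lt_one (by
      rw [norm_pow]; exact pow_lt_one₀ (norm_nonneg _) hq hm.ne')
  have hinj : Function.Injective (fun j : ℕ ↦ m * j) := fun a b h ↦
    Nat.eq_of_mul_eq_mul_left hm h
  rw [← hinj.hasSum_iff]
  · convert h1 using 2 with j
    simp [pow_mul]
  · intro n hn
    have : ¬ m ∣ n := fun ⟨k, hk⟩ ↦ hn ⟨k, hk.symm⟩
    simp [this]

lemma summable_ite_dvd {m : ℕ} {q : ℂ} (hq : ‖q‖ < 1) :
    Summable fun n : ℕ ↦ ‖(if m ∣ n then (1 : ℂ) else 0) * q ^ n‖ := by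
  refine Summable.of_nonneg_of_le (fun _ ↦ norm_nonneg _) (fun n ↦ ?_)
    (summable_geometric_of_lt_one (norm_nonneg q) hq)
  rw [norm_mul, norm_pow]
  split_ifs <;> simp

lemma pBounded_hasSum (K : ℕ) {q : ℂ} (hq : ‖q‖ < 1) :
    Summable (fun n : ℕ ↦ ‖(pBounded K n : ℂ) * q ^ n‖) ∧
    HasSum (fun n : ℕ ↦ (pBounded K n : ℂ) * q ^ n)
      (∏ i ∈ Finset.range K, (1 - q ^ (i + 1))⁻¹) := by
  induction K with
  | zero =>
    have h0 : ∀ n, pBounded 0 n = if n = 0 then 1 else 0 := fun n ↦ by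
      simp [pBounded, PowerSeries.coeff_one]
    constructor
    · refine summable_of_ne_finset_zero (s := {0}) fun n hn ↦ ?_
      simp at hn
      simp [h0, hn]
    · simp only [Finset.range_zero, Finset.prod_empty]
      convert hasSum_ite_eq (0 : ℕ) (1 : ℂ) using 2 with n
      rcases eq_or_ne n 0 with rfl | hn
      · simp [h0]
      · simp [h0, hn]
  | succ K ih =>
    obtain ⟨hs, hv⟩ := ih
    have hs' := summable_ite_dvd (m := K + 1) hq
    have hv' := hasSum_ite_dvd (Nat.succ_pos K) hq
    have key : ∀ n, (pBounded (K + 1) n : ℂ) * q ^ n =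
        ∑ kl ∈ Finset.HasAntidiagonal.antidiagonal n, ((pBounded K kl.1 : ℂ) * q ^ kl.1) *
          ((if K + 1 ∣ kl.2 then (1 : ℂ) else 0) * q ^ kl.2) := fun n ↦ by
      rw [pBounded_succ]
      push_cast
      rw [Finset.sum_mul]
      refine Finset.sum_congr rfl fun kl hkl ↦ ?_
      rw [← Finset.HasAntidiagonal.mem_antidiagonal.1 hkl, pow_add]
      split_ifs <;> push_cast <;> ring
    have hS := summable_norm_sum_mul_antidiagonal_of_summable_norm hs hs'
    have hT := tsum_mul_tsum_eq_tsum_sum_antidiagonal_of_summable_norm hs hs'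
    simp_rw [← key] at hS hT
    refine ⟨hS, ?_⟩
    rw [Finset.prod_range_succ, ← hv.tsum_eq, ← hv'.tsum_eq, Nat.succ_eq_add_one, hT]
    exact hS.of_norm.hasSum

/-- Euler's product `∏ (1 - q ^ k)`. -/
noncomputable def euler (q : ℂ) : ℂ := ∏' n : ℕ, (1 - q ^ (n + 1))

lemma multipliable_euler {q : ℂ} (hq : ‖q‖ < 1) : Multipliable fun n : ℕ ↦ (1 - q ^ (n + 1)) := by
  have : Summable fun n : ℕ ↦ ‖-(q ^ (n + 1))‖ := by
    simp only [norm_neg, norm_pow]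
    exact (summable_nat_add_iff 1).2 (summable_geometric_of_lt_one (norm_nonneg q) hq)
  simpa [sub_eq_add_neg] using multipliable_one_add_of_summable this

lemma norm_euler_sub_one_le {q : ℂ} (hq : ‖q‖ < 1) :
    ‖euler q - 1‖ ≤ exp (‖q‖ / (1 - ‖q‖)) - 1 := by
  have h := (multipliable_euler hq).hasProd.tendsto_prod_nat
  have h2 : Tendsto (fun K ↦ ‖∏ i ∈ Finset.range K, (1 - q ^ (i + 1)) - 1‖) atTop
      (𝓝 ‖euler q - 1‖) := (h.sub_const 1).norm
  refine le_of_tendsto' h2 fun K ↦ ?_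
  have h3 := Finset.norm_prod_one_add_sub_one_le (Finset.range K) (fun i ↦ -(q ^ (i + 1)))
  simp only [← sub_eq_add_neg, norm_neg, norm_pow] at h3
  refine h3.trans (sub_le_sub_right (exp_le_exp.2 ?_) _)
  have hs : Summable fun n : ℕ ↦ ‖q‖ ^ (n + 1) :=
    (summable_nat_add_iff 1).2 (summable_geometric_of_lt_one (norm_nonneg q) hq)
  refine (hs.sum_le_tsum _ fun _ _ ↦ by positivity).trans_eq ?_
  simp_rw [pow_succ]
  rw [tsum_mul_right, tsum_geometric_of_lt_one (norm_nonneg q) hq]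
  ring

lemma euler_ne_zero {q : ℂ} (hq : ‖q‖ < 1) : euler q ≠ 0 := by
  have : Summable fun n : ℕ ↦ ‖-(q ^ (n + 1))‖ := by
    simp only [norm_neg, norm_pow]
    exact (summable_nat_add_iff 1).2 (summable_geometric_of_lt_one (norm_nonneg q) hq)
  have h := tprod_one_add_ne_zero_of_summable (f := fun n : ℕ ↦ -(q ^ (n + 1))) (fun n ↦ by
    rw [← sub_eq_add_neg, sub_ne_zero]
    intro h
    have h1 : ‖q ^ (n + 1)‖ < 1 := by
      rw [norm_pow]; exact pow_lt_one₀ (norm_nonneg _) hq (Nat.succ_ne_zero n)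
    rw [← h] at h1
    simp at h1) this
  simpa [euler, sub_eq_add_neg] using h

lemma tendsto_prod_inv {q : ℂ} (hq : ‖q‖ < 1) :
    Tendsto (fun K ↦ ∏ i ∈ Finset.range K, (1 - q ^ (i + 1))⁻¹) atTop (𝓝 (euler q)⁻¹) := by
  simp_rw [Finset.prod_inv_distrib]
  exact (multipliable_euler hq).hasProd.tendsto_prod_nat.inv₀ (euler_ne_zero hq)

lemma p_nonneg (n : ℕ) : 0 ≤ p n := Nat.cast_nonneg _

lemma summable_p {r : ℝ} (h0 : 0 ≤ r) (hr : r < 1) : Summable fun n ↦ p n * r ^ n := by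
  have hq : ‖(r : ℂ)‖ < 1 := by simpa [abs_of_nonneg h0] using hr
  obtain ⟨B, hB⟩ := (tendsto_prod_inv hq).norm.bddAbove_range
  refine summable_of_sum_range_le (c := B) (fun n ↦ mul_nonneg (p_nonneg n) (by positivity))
    fun m ↦ ?_
  have h1 : Tendsto (fun K ↦ ∑ i ∈ Finset.range m, pBounded K i * r ^ i) atTop
      (𝓝 (∑ i ∈ Finset.range m, p i * r ^ i)) :=
    tendsto_finsetSum _ fun i _ ↦ (tendsto_pBounded i).mul_const _
  refine le_of_tendsto' h1 fun K ↦ ?_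
  obtain ⟨hs, hv⟩ := pBounded_hasSum K hq
  have hn : ∀ i, ‖(pBounded K i : ℂ) * (r : ℂ) ^ i‖ = pBounded K i * r ^ i := fun i ↦ by
    rw [norm_mul, norm_pow, Complex.norm_real, Complex.norm_real, norm_of_nonneg h0,
      norm_of_nonneg (pBounded_nonneg K i)]
  simp_rw [hn] at hs
  refine (hs.sum_le_tsum _ fun i _ ↦ mul_nonneg (pBounded_nonneg K i) (by positivity)).trans ?_
  refine le_trans ?_ (hB ⟨K, rfl⟩)
  simp only
  rw [← hv.tsum_eq]
  refine le_trans (le_abs_self _) ?_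
  rw [← Real.norm_eq_abs, ← Complex.norm_real]
  push_cast
  rfl

lemma hasSum_p {q : ℂ} (hq : ‖q‖ < 1) : HasSum (fun n ↦ (p n : ℂ) * q ^ n) (euler q)⁻¹ := by
  have hs := summable_p (norm_nonneg q) hq
  have hs' : Summable fun n ↦ (p n : ℂ) * q ^ n := by
    refine Summable.of_norm ?_
    simpa [abs_of_nonneg (p_nonneg _)] using hs
  have h1 : Tendsto (fun K ↦ ∑' n, (pBounded K n : ℂ) * q ^ n) atTop
      (𝓝 (∑' n, (p n : ℂ) * q ^ n)) := by
    refine tendsto_tsum_of_dominated_convergence hs (fun n ↦ ?_) (Eventually.of_forall fun K n ↦ ?_)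
    · exact (((Complex.continuous_ofReal.tendsto _).comp (tendsto_pBounded n)).mul_const _)
    · rw [norm_mul, norm_pow, Complex.norm_real, norm_of_nonneg (pBounded_nonneg K n)]
      exact mul_le_mul_of_nonneg_right (pBounded_le K n) (by positivity)
  have h2 : ∀ K, ∑' n, (pBounded K n : ℂ) * q ^ n = ∏ i ∈ Finset.range K, (1 - q ^ (i + 1))⁻¹ :=
    fun K ↦ (pBounded_hasSum K hq).2.tsum_eq
  simp_rw [h2] at h1
  rw [← tendsto_nhds_unique h1 (tendsto_prod_inv hq)]
  exact hs'.hasSum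

lemma norm_exp_two_pi_I_mul (z : ℂ) :
    ‖Complex.exp (2 * π * Complex.I * z)‖ = exp (-(2 * π * z.im)) := by
  rw [Complex.norm_exp]
  congr 1
  simp

lemma eta_eq (z : ℂ) : ModularForm.eta z =
    Complex.exp (2 * π * Complex.I * z / 24) * euler (Complex.exp (2 * π * Complex.I * z)) := by
  rw [ModularForm.eta, euler, Function.Periodic.qParam]
  congr 1
  refine tprod_congr fun n ↦ ?_
  rw [ModularForm.eta_q_eq_pow]

lemma integral_exp_int (k : ℤ) (hk : k ≠ 0) (a : ℝ) :
    ∫ x in a..(a + 1), Complex.exp (2 * π * Complex.I * k * x) = 0 := by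
  have hc : (2 * π * Complex.I * k : ℂ) ≠ 0 := by
    simp [Real.pi_ne_zero, Complex.I_ne_zero, hk]
  rw [integral_exp_mul_complex hc]
  have : Complex.exp (2 * π * Complex.I * k * ((a + 1 : ℝ) : ℂ)) =
      Complex.exp (2 * π * Complex.I * k * (a : ℂ)) := by
    rw [Complex.exp_eq_exp_iff_exists_int]
    exact ⟨k, by push_cast; ring⟩
  rw [this]; simp

lemma integral_exp_sub (m n : ℕ) (a : ℝ) :
    ∫ x in a..(a + 1), Complex.exp (2 * π * Complex.I * ((m : ℂ) - n) * x) =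
      if m = n then 1 else 0 := by
  split_ifs with h
  · simp [h]
  · have := integral_exp_int ((m : ℤ) - n) (by omega) a
    push_cast at this
    exact this

/-- The partition numbers as Fourier coefficients of `1 / η` along a horizontal line. -/
lemma p_eq_integral (n : ℕ) {y : ℝ} (hy : 0 < y) (a : ℝ) :
    (p n : ℂ) = ∫ x in a..(a + 1),
      Complex.exp (-(2 * π * Complex.I * (n - 1 / 24) * (x + y * Complex.I))) /
        ModularForm.eta (x + y * Complex.I) := by
  set r : ℝ := exp (-(2 * π * y)) with hr
  have hpi := Real.pi_pos
  have hr1 : r < 1 := by rw [hr, Real.exp_lt_one_iff]; simp; positivity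
  have hr0 : 0 ≤ r := (exp_pos _).le
  have hq : ∀ x : ℝ, ‖Complex.exp (2 * π * Complex.I * (x + y * Complex.I))‖ = r := fun x ↦ by
    rw [norm_exp_two_pi_I_mul]; simp [hr]
  have h1 : HasSum (fun m ↦ ∫ x in a..(a + 1),
      (p m : ℂ) * Complex.exp (2 * π * Complex.I * (x + y * Complex.I)) ^ m *
        Complex.exp (-(2 * π * Complex.I * n * (x + y * Complex.I))))
      (∫ x in a..(a + 1), (euler (Complex.exp (2 * π * Complex.I * (x + y * Complex.I))))⁻¹ *
        Complex.exp (-(2 * π * Complex.I * n * (x + y * Complex.I)))) := by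
    refine intervalIntegral.hasSum_integral_of_dominated_convergence
      (fun m _ ↦ p m * r ^ m * exp (2 * π * n * y)) (fun m ↦ ?_) (fun m ↦ ?_) ?_ ?_ ?_
    · exact Continuous.aestronglyMeasurable (by fun_prop)
    · refine Eventually.of_forall fun x _ ↦ le_of_eq ?_
      rw [norm_mul, norm_mul, norm_pow, hq, Complex.norm_real, norm_of_nonneg (p_nonneg m),
        Complex.norm_exp]
      congr 2
      simp
    · exact Eventually.of_forall fun x _ ↦ (summable_p hr0 hr1).mul_right _
    · exact intervalIntegrable_const
    · exact Eventually.of_forall fun x _ ↦ (hasSum_p ((hq x).trans_lt hr1)).mul_right _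
  have h2 : ∀ m, (∫ x in a..(a + 1),
      (p m : ℂ) * Complex.exp (2 * π * Complex.I * (x + y * Complex.I)) ^ m *
        Complex.exp (-(2 * π * Complex.I * n * (x + y * Complex.I)))) =
      if m = n then (p n : ℂ) else 0 := by
    intro m
    have : ∀ x : ℝ, (p m : ℂ) * Complex.exp (2 * π * Complex.I * (x + y * Complex.I)) ^ m *
        Complex.exp (-(2 * π * Complex.I * n * (x + y * Complex.I))) =
        (p m * Complex.exp (2 * π * Complex.I * (m - n) * (y * Complex.I))) *
          Complex.exp (2 * π * Complex.I * ((m : ℂ) - n) * x) := fun x ↦ by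
      rw [← Complex.exp_nat_mul, mul_assoc, ← Complex.exp_add, mul_assoc (p m : ℂ),
        ← Complex.exp_add]
      congr 2
      ring
    simp_rw [this]
    rw [intervalIntegral.integral_const_mul, integral_exp_sub]
    split_ifs with h
    · simp [h]
    · simp
  simp_rw [h2] at h1
  rw [(hasSum_ite_eq n (p n : ℂ)).unique h1]
  refine intervalIntegral.integral_congr fun x _ ↦ ?_
  rw [eta_eq, div_eq_mul_inv, mul_inv, ← Complex.exp_neg, ← mul_assoc, ← Complex.exp_add, mul_comm]
  congr 2
  ring

lemma norm_euler_inv_le {q : ℂ} (hq : ‖q‖ ≤ 1 / 120) : ‖(euler q)⁻¹‖ ≤ 101 / 100 := by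
  have h1 := norm_euler_sub_one_le (hq.trans_lt (by norm_num))
  have h2 : ‖q‖ / (1 - ‖q‖) ≤ 1 / 119 := by
    rw [div_le_div_iff₀ (by linarith) (by norm_num)]; linarith
  have h3 : exp (‖q‖ / (1 - ‖q‖)) ≤ 1 + 1 / 101 := by
    refine (exp_le_exp.2 h2).trans ?_
    have := Real.exp_bound' (x := 1 / 119) (by norm_num) (by norm_num) (n := 2) (by norm_num)
    refine this.trans ?_
    norm_num [Finset.sum_range_succ, Nat.factorial]
  have h4 : 1 - ‖euler q - 1‖ ≤ ‖euler q‖ := by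
    have := norm_sub_norm_le (1 : ℂ) (1 - euler q)
    rw [norm_one, sub_sub_cancel, norm_sub_rev] at this
    exact this
  rw [norm_inv, inv_le_comm₀ (by linarith) (by norm_num)]
  linarith

open UpperHalfPlane in
lemma norm_eta_inv_le_of_im {z : ℂ} (hz0 : 0 < z.im) (hz : 3 ≤ 4 * z.im ^ 2) :
    ‖(ModularForm.eta z)⁻¹‖ ≤ 101 / 100 * exp (π * z.im / 12) := by
  have hpi := Real.pi_gt_d2
  have him : 86 / 100 ≤ z.im := by nlinarith
  have hq : ‖Complex.exp (2 * π * Complex.I * z)‖ ≤ 1 / 120 := by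
    rw [norm_exp_two_pi_I_mul, Real.exp_neg, one_div, inv_le_inv₀ (exp_pos _) (by norm_num)]
    have h5 : (5 : ℝ) ≤ 2 * π * z.im := by nlinarith
    have h6 : (120 : ℝ) ≤ exp 1 ^ 5 := by
      have := Real.exp_one_gt_d9
      calc (120 : ℝ) ≤ 2.71 ^ 5 := by norm_num
        _ ≤ exp 1 ^ 5 := by gcongr; linarith
    calc (120 : ℝ) ≤ exp 1 ^ 5 := h6
      _ = exp 5 := by rw [← Real.exp_nat_mul]; norm_num
      _ ≤ _ := exp_le_exp.2 h5
  rw [eta_eq, mul_inv, norm_mul, ← Complex.exp_neg, Complex.norm_exp, mul_comm]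
  refine mul_le_mul (norm_euler_inv_le hq) (le_of_eq ?_) (exp_pos _).le (by norm_num)
  congr 1
  rw [show -(2 * π * Complex.I * z / 24) = ((-(π / 12) : ℝ) : ℂ) * (Complex.I * z) by
    push_cast; ring, Complex.re_ofReal_mul]
  simp; ring

open UpperHalfPlane in
lemma norm_eta_smul (g : Matrix.SpecialLinearGroup (Fin 2) ℤ) (z : ℍ) :
    ‖ModularForm.eta ↑(g • z)‖ ^ 24 =
      (‖(g 1 0 : ℂ) * z + g 1 1‖ ^ 2) ^ 6 * ‖ModularForm.eta z‖ ^ 24 := by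
  have hmem : Matrix.SpecialLinearGroup.toGL
      ((Matrix.SpecialLinearGroup.map (Int.castRingHom ℝ)) g) ∈ MonoidHom.range
        (Matrix.SpecialLinearGroup.mapGL (n := Fin 2) (R := ℤ) ℝ) := ⟨g, rfl⟩
  have h := SlashInvariantForm.slash_action_eqn'' CuspForm.discriminant hmem z
  rw [CuspForm.coe_discriminant, ← ModularGroup.sl_moeb, ModularGroup.denom_apply] at h
  have h2 := congrArg norm h
  rw [ModularForm.discriminant, ModularForm.discriminant] at h2
  rw [norm_pow, norm_mul, norm_pow] at h2
  rw [h2, ← pow_mul, zpow_ofNat, norm_pow]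

open UpperHalfPlane in
lemma exists_norm_eta_inv_le (x : ℝ) {y : ℝ} (hy : 0 < y) :
    ∃ c d : ℤ, IsCoprime c d ∧ 0 < (c * x + d) ^ 2 + (c * y) ^ 2 ∧
      3 * ((c * x + d) ^ 2 + (c * y) ^ 2) ^ 2 ≤ 4 * y ^ 2 ∧
      ‖(ModularForm.eta (x + y * Complex.I))⁻¹‖ ≤
        101 / 100 * ((c * x + d) ^ 2 + (c * y) ^ 2) ^ (1 / 4 : ℝ) *
          exp (π * y / (12 * ((c * x + d) ^ 2 + (c * y) ^ 2))) := by
  let z : ℍ := ⟨x + y * Complex.I, by simpa using hy⟩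
  obtain ⟨g, hg⟩ := ModularGroup.exists_smul_mem_fd z
  have h3 := ModularGroup.three_le_four_mul_im_sq_of_mem_fd hg
  have hD : ‖(g 1 0 : ℂ) * z + g 1 1‖ ^ 2 = (g 1 0 * x + g 1 1) ^ 2 + (g 1 0 * y) ^ 2 := by
    rw [← Complex.normSq_eq_norm_sq, Complex.normSq_apply]
    simp [z]; ring
  have him : (g • z).im = y / ((g 1 0 * x + g 1 1) ^ 2 + (g 1 0 * y) ^ 2) := by
    rw [ModularGroup.im_smul_eq_div_normSq, ModularGroup.denom_apply, Complex.normSq_eq_norm_sq,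
      hD]
    simp [z, UpperHalfPlane.im]
  have hnorm := norm_eta_smul g z
  rw [hD] at hnorm
  have him0 := (g • z).im_pos
  have hle := norm_eta_inv_le_of_im (z := ↑(g • z)) him0 h3
  change _ ≤ 101 / 100 * exp (π * (g • z).im / 12) at hle
  refine ⟨g 1 0, g 1 1, g.isCoprime_row 1, ?_⟩
  generalize hDD : ((g 1 0 : ℝ) * x + g 1 1) ^ 2 + (g 1 0 * y) ^ 2 = D at *
  have hD0 : 0 < D := by
    rw [him] at him0
    exact (div_pos_iff_of_pos_left hy).1 him0
  refine ⟨hD0, ?_, ?_⟩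
  · rw [him, div_pow, mul_div_assoc', le_div_iff₀ (by positivity)] at h3
    exact h3
  · have hz : (z : ℂ) = x + y * Complex.I := rfl
    rw [hz] at hnorm
    have e1 : ‖ModularForm.eta ↑(g • z)‖ =
        D ^ (1 / 4 : ℝ) * ‖ModularForm.eta (x + y * Complex.I)‖ := by
      rw [← pow_left_inj₀ (norm_nonneg _) (by positivity) (by norm_num : 24 ≠ 0), hnorm, mul_pow,
        ← Real.rpow_mul_natCast hD0.le]
      norm_num
    rw [norm_inv, e1, mul_inv, him] at hle
    rw [norm_inv]
    have hDp : 0 < D ^ (1 / 4 : ℝ) := Real.rpow_pos_of_pos hD0 _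
    rw [inv_mul_le_iff₀ hDp] at hle
    refine hle.trans (le_of_eq ?_)
    rw [show π * (y / D) / 12 = π * y / (12 * D) by field_simp]
    ring


lemma far_bound_mono {y D : ℝ} (hy : 0 < y) (hD0 : 0 < D) (hD : D ≤ 6 / 5 * y)
    (hD9 : 9 * y ^ 2 ≤ D) :
    101 / 100 * D ^ (1 / 4 : ℝ) * exp (π * y / (12 * D)) ≤
      101 / 100 * (6 / 5 * y) ^ (1 / 4 : ℝ) * exp (π / (108 * y)) := by
  refine mul_le_mul ?_ ?_ (exp_pos _).le (by positivity)
  · gcongr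
  · rw [exp_le_exp, div_le_div_iff₀ (by positivity) (by positivity)]
    nlinarith [mul_le_mul_of_nonneg_left hD9 pi_pos.le]

set_option maxHeartbeats 1000000 in
lemma norm_eta_inv_le_of_far {x y X : ℝ} (hy : 0 < y) (hy1 : y ≤ 1 / 10) (hX0 : 0 ≤ X)
    (hX : X ^ 2 + y ^ 2 = 2 * y) (hx : X ≤ x) (hx' : x ≤ 1 - X) :
    ‖(ModularForm.eta (x + y * Complex.I))⁻¹‖ ≤
        101 / 100 * (6 / 5 * y) ^ (1 / 4 : ℝ) * exp (π / (108 * y)) ∨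
      (3 * (4 * ((x - 1 / 2) ^ 2 + y ^ 2)) ^ 2 ≤ 4 * y ^ 2 ∧
        ‖(ModularForm.eta (x + y * Complex.I))⁻¹‖ ≤
          101 / 100 * (4 * ((x - 1 / 2) ^ 2 + y ^ 2)) ^ (1 / 4 : ℝ) *
            exp (π * y / (12 * (4 * ((x - 1 / 2) ^ 2 + y ^ 2))))) := by
  obtain ⟨c, d, hcd, hD0, hD, hle⟩ := exists_norm_eta_inv_le x hy
  have hDle : (c * x + d) ^ 2 + (c * y) ^ 2 ≤ 6 / 5 * y := by
    refine abs_le_of_sq_le_sq' ?_ (by positivity) |>.2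
    nlinarith
  have hpi := Real.pi_pos
  rcases lt_or_ge (|c|) 3 with hc | hc
  · have h1 := abs_lt.1 hc
    have hcc : c = -2 ∨ c = -1 ∨ c = 0 ∨ c = 1 ∨ c = 2 := by omega
    have hone (e : ℝ) (he : 1 ≤ |e|) : 1 ≤ e ^ 2 := by
      rw [← sq_abs]; nlinarith
    have h_sq (k : ℤ) : X ^ 2 ≤ (x + k) ^ 2 := by
      rcases le_or_gt 0 k with hk | hk
      · have : (0 : ℝ) ≤ k := by exact_mod_cast hk
        nlinarith
      · have : (k : ℝ) ≤ -1 := by exact_mod_cast (by omega : k ≤ -1)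
        nlinarith
    have hhalf (k : ℤ) (hk : Odd k) (hkn : k ≠ -1) : 1 ≤ (2 * x + k) ^ 2 := by
      obtain ⟨l, rfl⟩ := hk
      rcases le_or_gt 0 l with hl | hl
      · have : (0 : ℝ) ≤ l := by exact_mod_cast hl
        push_cast
        nlinarith
      · have : (l : ℝ) ≤ -2 := by exact_mod_cast (by omega : l ≤ -2)
        push_cast
        nlinarith
    right
    have key : (c * x + d) ^ 2 + (c * y) ^ 2 = 4 * ((x - 1 / 2) ^ 2 + y ^ 2) := by
      rcases hcc with rfl | rfl | rfl | rfl | rfl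
      · have hodd : Odd (-d) := by
          rw [← Int.not_even_iff_odd, even_neg]
          rintro ⟨m, hm⟩
          obtain ⟨u, v, huv⟩ := hcd
          have : 2 * (-u + v * m) = 1 := by
            rw [← huv]; linear_combination -v * hm
          omega
        by_cases hd : -d = -1
        · have : d = 1 := by omega
          subst this; push_cast; ring
        · have := hhalf _ hodd hd
          push_cast at hDle this
          nlinarith
      · have := h_sq (-d)
        push_cast at hDle this
        nlinarith
      · have : d ≠ 0 := by rintro rfl; simp at hD0
        have h2 : 1 ≤ |(d : ℝ)| := by exact_mod_cast Int.one_le_abs this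
        have := hone _ h2
        push_cast at hDle
        nlinarith
      · have := h_sq d
        push_cast at hDle this
        nlinarith
      · have hodd : Odd d := by
          rw [← Int.not_even_iff_odd]
          rintro ⟨m, hm⟩
          obtain ⟨u, v, huv⟩ := hcd
          have : 2 * (u + v * m) = 1 := by
            rw [← huv]; linear_combination -v * hm
          omega
        by_cases hd : d = -1
        · subst hd; push_cast; ring
        · have := hhalf _ hodd hd
          push_cast at hDle this
          nlinarith
    rw [key] at hD hle
    exact ⟨hD, hle⟩
  · left
    have hc3 : (9 : ℝ) ≤ (c : ℝ) ^ 2 := by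
      rw [← sq_abs]
      have : (3 : ℝ) ≤ |(c : ℝ)| := by exact_mod_cast hc
      nlinarith
    refine hle.trans (far_bound_mono hy hD0 hDle ?_)
    rw [mul_pow]
    nlinarith [sq_nonneg (c * x + d), mul_le_mul_of_nonneg_right hc3 (sq_nonneg y)]

section PeriodIntegral

open MeasureTheory

lemma rpow_quarter_le {x b : ℝ} (hx : 0 ≤ x) (hb : 0 ≤ b) (h : x ≤ b ^ 4) :
    x ^ (1 / 4 : ℝ) ≤ b := by
  calc x ^ (1 / 4 : ℝ) ≤ (b ^ 4) ^ (1 / 4 : ℝ) := by gcongr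
    _ = b := by
      rw [← Real.rpow_natCast, ← Real.rpow_mul hb]; norm_num

set_option maxHeartbeats 1000000 in
lemma norm_eta_inv_le_sum {L x X : ℝ} (hL : 154 ≤ L) (hX0 : 0 ≤ X)
    (hX : X ^ 2 + (1 / (2 * L)) ^ 2 = 2 * (1 / (2 * L))) (hx : X ≤ x) (hx' : x ≤ 1 - X) :
    ‖(ModularForm.eta (x + (1 / (2 * L) : ℝ) * Complex.I))⁻¹‖ ≤ 101 / 100 * (
      1 / 4 * exp (π * L / 54) +
      10574 / 10000 / √L * exp (π * L / 24) * exp (-(2 * π * L ^ 3 / 15) * (x - 1 / 2) ^ 2) +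
      (Set.Icc (1 / 2 - 56 / 100 / L) (1 / 2 + 56 / 100 / L)).indicator
        (fun _ ↦ 1225 / 1000 / √L * exp (π * L / 30)) x) := by
  have hL0 : 0 < L := by linarith
  have hpi := pi_pos
  have hsq : √L ^ 4 = L ^ 2 := by
    rw [show (4 : ℕ) = 2 * 2 from rfl, pow_mul, Real.sq_sqrt hL0.le]
  have hy : 0 < 1 / (2 * L) := by positivity
  have hy1 : 1 / (2 * L) ≤ 1 / 10 := by
    rw [div_le_div_iff₀ (by positivity) (by norm_num)]; linarith
  have hind : 0 ≤ (Set.Icc (1 / 2 - 56 / 100 / L) (1 / 2 + 56 / 100 / L)).indicator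
        (fun _ ↦ 1225 / 1000 / √L * exp (π * L / 30)) x :=
    Set.indicator_nonneg (fun _ _ ↦ by positivity) _
  have hG : 0 ≤ 10574 / 10000 / √L * exp (π * L / 24) *
    exp (-(2 * π * L ^ 3 / 15) * (x - 1 / 2) ^ 2) := by positivity
  have hK3 : (6 / 5 * (1 / (2 * L))) ^ (1 / 4 : ℝ) ≤ 1 / 4 := by
    refine rpow_quarter_le (by positivity) (by norm_num) ?_
    rw [← mul_div_assoc, div_le_iff₀ (by positivity)]
    norm_num; linarith
  have hK4 : exp (π / (108 * (1 / (2 * L)))) = exp (π * L / 54) := by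
    congr 1; field_simp; norm_num
  rcases norm_eta_inv_le_of_far hy hy1 hX0 hX hx hx' with h | ⟨h1, h⟩
  · rw [hK4] at h
    refine h.trans ?_
    rw [mul_assoc]
    gcongr
    nlinarith [exp_pos (π * L / 54)]
  · set D : ℝ := 4 * ((x - 1 / 2) ^ 2 + (1 / (2 * L)) ^ 2) with hDdef
    have hD : D * L ^ 2 = 1 + 4 * L ^ 2 * (x - 1 / 2) ^ 2 := by
      rw [hDdef]; field_simp; ring
    have hD0 : 0 < D := by positivity
    have hDle : D ≤ 6 / 5 * (1 / (2 * L)) := by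
      refine abs_le_of_sq_le_sq' ?_ (by positivity) |>.2
      nlinarith
    have hE : π * (1 / (2 * L)) / (12 * D) = π * L / 24 / (D * L ^ 2) := by
      field_simp; norm_num
    rw [hE] at h
    have h5 : 0 < D * L ^ 2 := by positivity
    refine h.trans ?_
    rw [mul_assoc]
    refine mul_le_mul_of_nonneg_left ?_ (by norm_num)
    generalize hS : 4 * L ^ 2 * (x - 1 / 2) ^ 2 = S at *
    have hS0 : 0 ≤ S := by rw [← hS]; positivity
    rcases le_or_gt S (1 / 4) with hs | hs
    · have e1 : D ^ (1 / 4 : ℝ) ≤ 10574 / 10000 / √L := by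
        refine rpow_quarter_le hD0.le (by positivity) ?_
        rw [div_pow, hsq, le_div_iff₀ (by positivity), hD]
        norm_num; linarith
      have e2 : exp (π * L / 24 / (D * L ^ 2)) ≤ exp (π * L / 24) *
          exp (-(2 * π * L ^ 3 / 15) * (x - 1 / 2) ^ 2) := by
        rw [← exp_add, exp_le_exp, div_le_iff₀ h5, hD]
        have : 2 * π * L ^ 3 / 15 * (x - 1 / 2) ^ 2 = π * L / 24 * (4 / 5 * S) := by
          rw [← hS]; ring
        rw [neg_mul, this]
        have hp : 0 < π * L / 24 := by positivity
        have h6 : 1 ≤ (1 - 4 / 5 * S) * (1 + S) := by nlinarith only [hs, hS0]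
        linarith only [mul_le_mul_of_nonneg_left h6 hp.le]
      calc _ ≤ 10574 / 10000 / √L * (exp (π * L / 24) *
          exp (-(2 * π * L ^ 3 / 15) * (x - 1 / 2) ^ 2)) :=
            mul_le_mul e1 e2 (exp_pos _).le (by positivity)
        _ ≤ _ := by nlinarith [exp_pos (π * L / 54)]
    · rcases le_or_gt S (5 / 4) with hs' | hs'
      · have hmem : x ∈ Set.Icc (1 / 2 - 56 / 100 / L) (1 / 2 + 56 / 100 / L) := by
          have : |x - 1 / 2| ≤ 56 / 100 / L := by
            refine abs_le_of_sq_le_sq ?_ (by positivity)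
            rw [div_pow, le_div_iff₀ (by positivity)]
            nlinarith
          have := abs_le.1 this
          constructor <;> linarith
        rw [Set.indicator_of_mem hmem]
        have e1 : D ^ (1 / 4 : ℝ) ≤ 1225 / 1000 / √L := by
          refine rpow_quarter_le hD0.le (by positivity) ?_
          rw [div_pow, hsq, le_div_iff₀ (by positivity), hD]
          norm_num; linarith
        have e2 : exp (π * L / 24 / (D * L ^ 2)) ≤ exp (π * L / 30) := by
          rw [exp_le_exp, div_le_iff₀ h5, hD]
          nlinarith [mul_pos hpi hL0]
        calc _ ≤ 1225 / 1000 / √L * exp (π * L / 30) :=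
              mul_le_mul e1 e2 (exp_pos _).le (by positivity)
          _ ≤ _ := by nlinarith [exp_pos (π * L / 54)]
      · have e1 : D ^ (1 / 4 : ℝ) ≤ 1 / 4 := le_trans (by gcongr) hK3
        have e2 : exp (π * L / 24 / (D * L ^ 2)) ≤ exp (π * L / 54) := by
          rw [exp_le_exp, div_le_iff₀ h5, hD]
          nlinarith [mul_pos hpi hL0]
        calc _ ≤ 1 / 4 * exp (π * L / 54) :=
              mul_le_mul e1 e2 (exp_pos _).le (by positivity)
          _ ≤ _ := by nlinarith [exp_pos (π * L / 54)]

lemma integral_indicator_Icc_const {a b k : ℝ} (hab : a ≤ b) :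
    Integrable ((Set.Icc a b).indicator fun _ ↦ k) ∧
      ∫ x, (Set.Icc a b).indicator (fun _ ↦ k) x = (b - a) * k := by
  constructor
  · rw [integrable_indicator_iff measurableSet_Icc]
    exact integrableOn_const (by simp)
  · rw [integral_indicator_const _ measurableSet_Icc]
    simp [hab]

lemma norm_integral_far_le {L X : ℝ} (n : ℕ) (hn : L ^ 2 = 24 * n - 1) (hL : 154 ≤ L)
    (hX0 : 0 ≤ X) (hX1 : X ≤ 1 / 2)
    (hX : X ^ 2 + (1 / (2 * L)) ^ 2 = 2 * (1 / (2 * L))) :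
    ‖∫ x in X..(1 - X),
      Complex.exp (-(2 * π * Complex.I * (n - 1 / 24) * (x + (1 / (2 * L) : ℝ) * Complex.I))) /
        ModularForm.eta (x + (1 / (2 * L) : ℝ) * Complex.I)‖ ≤
      101 / 100 * exp (π * L / 24) * (1 / 4 * exp (π * L / 54) +
        10574 / 10000 * √(15 / 2) / L ^ 2 * exp (π * L / 24) +
        1372 / 1000 / (L * √L) * exp (π * L / 30)) := by
  have hL0 : 0 < L := by linarith
  have hpi := pi_pos
  have hb : 0 < 2 * π * L ^ 3 / 15 := by positivity
  have hab : 1 / 2 - 56 / 100 / L ≤ 1 / 2 + 56 / 100 / L := by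
    have : 0 < 56 / 100 / L := by positivity
    linarith
  set E := exp (π * L / 24)
  set g1 : ℝ → ℝ := fun _ ↦ E * (101 / 100) * (1 / 4 * exp (π * L / 54)) with hg1
  set g2 : ℝ → ℝ := fun x ↦ E * (101 / 100) * (10574 / 10000 / √L * E) *
    exp (-(2 * π * L ^ 3 / 15) * (x - 1 / 2) ^ 2) with hg2
  set g3 : ℝ → ℝ := (Set.Icc (1 / 2 - 56 / 100 / L) (1 / 2 + 56 / 100 / L)).indicator
        (fun _ ↦ E * (101 / 100) * (1225 / 1000 / √L * exp (π * L / 30))) with hg3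
  have i2 : Integrable g2 := by
    have := (integrable_exp_neg_mul_sq hb).comp_sub_right (1 / 2 : ℝ)
    exact this.const_mul _
  have i3 : Integrable g3 := (integral_indicator_Icc_const hab).1
  have v2 : ∫ x, g2 x = E * (101 / 100) * (10574 / 10000 * √(15 / 2) / L ^ 2 * E) := by
    rw [hg2, integral_const_mul,
      integral_sub_right_eq_self (fun x ↦ exp (-(2 * π * L ^ 3 / 15) * x ^ 2)) (1 / 2 : ℝ),
      integral_gaussian]
    have : π / (2 * π * L ^ 3 / 15) = 15 / 2 / L ^ 3 := by field_simp
    rw [this, Real.sqrt_div (by norm_num)]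
    have hs : √L * √(L ^ 3) = L ^ 2 := by
      rw [← Real.sqrt_mul hL0.le, show L * L ^ 3 = (L ^ 2) ^ 2 by ring,
        Real.sqrt_sq (by positivity)]
    rw [← hs]
    ring
  have v3 : ∫ x, g3 x = E * (101 / 100) * (1372 / 1000 / (L * √L) * exp (π * L / 30)) := by
    rw [hg3, (integral_indicator_Icc_const hab).2]
    ring
  have hXX : X ≤ 1 - X := by linarith
  have hbound : ∀ x ∈ Set.Ioc X (1 - X), ‖Complex.exp (-(2 * π * Complex.I * (n - 1 / 24) *
      (x + (1 / (2 * L) : ℝ) * Complex.I))) /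
        ModularForm.eta (x + (1 / (2 * L) : ℝ) * Complex.I)‖ ≤ g1 x + g2 x + g3 x := by
    intro x hx
    have h := norm_eta_inv_le_sum hL hX0 hX hx.1.le hx.2
    have hE : ‖Complex.exp (-(2 * π * Complex.I * (n - 1 / 24) *
      (x + (1 / (2 * L) : ℝ) * Complex.I)))‖ = E := by
      rw [Complex.norm_exp]
      congr 1
      have : (n : ℂ) - 1 / 24 = ((L ^ 2 / 24 : ℝ) : ℂ) := by rw [hn]; push_cast; ring
      rw [this]
      have : -(2 * π * Complex.I * ((L ^ 2 / 24 : ℝ) : ℂ) * (x + (1 / (2 * L) : ℝ) * Complex.I)) =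
        ((2 * π * (L ^ 2 / 24) * (1 / (2 * L)) : ℝ) : ℂ) +
          ((-(2 * π * (L ^ 2 / 24) * x) : ℝ) : ℂ) * Complex.I := by
        push_cast
        linear_combination (-(2 * π * (L ^ 2 / 24) * (1 / (2 * L))) : ℂ) * Complex.I_sq
      rw [this, Complex.add_re, Complex.ofReal_re, Complex.re_ofReal_mul, Complex.I_re, mul_zero,
        add_zero]
      field_simp
    rw [div_eq_mul_inv, norm_mul, hE]
    refine (mul_le_mul_of_nonneg_left h (exp_pos _).le).trans_eq ?_
    simp only [hg1, hg2, hg3, Set.indicator_apply]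
    split_ifs <;> ring
  have ii2 := i2.intervalIntegrable (a := X) (b := 1 - X)
  have ii3 := i3.intervalIntegrable (a := X) (b := 1 - X)
  have ii1 : IntervalIntegrable g1 volume X (1 - X) := intervalIntegrable_const
  refine (intervalIntegral.norm_integral_le_of_norm_le hXX (Eventually.of_forall hbound)
    ((ii1.add ii2).add ii3)).trans ?_
  rw [intervalIntegral.integral_add (ii1.add ii2) ii3, intervalIntegral.integral_add ii1 ii2]
  have n2 : 0 ≤ᵐ[volume] g2 := Eventually.of_forall fun x ↦ by simp only [hg2]; positivity
  have n3 : 0 ≤ᵐ[volume] g3 := Eventually.of_forall fun x ↦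
    Set.indicator_nonneg (fun _ _ ↦ by positivity) _
  have b2 : ∫ x in X..(1 - X), g2 x ≤ ∫ x, g2 x := by
    rw [intervalIntegral.integral_of_le hXX]
    exact setIntegral_le_integral i2 n2
  have b3 : ∫ x in X..(1 - X), g3 x ≤ ∫ x, g3 x := by
    rw [intervalIntegral.integral_of_le hXX]
    exact setIntegral_le_integral i3 n3
  have b1 : ∫ x in X..(1 - X), g1 x ≤ E * (101 / 100) * (1 / 4 * exp (π * L / 54)) := by
    rw [hg1, intervalIntegral.integral_const, smul_eq_mul]
    have : 0 ≤ E * (101 / 100) * (1 / 4 * exp (π * L / 54)) := by positivity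
    nlinarith
  rw [v2] at b2
  rw [v3] at b3
  linarith

lemma abs_integral_gaussian_sub_le {T : ℝ} (hT : 0 ≤ T) :
    |2 * (∫ t in (0 : ℝ)..T, exp (-t ^ 2)) - √π| ≤ 2 * √π * exp (-T ^ 2) := by
  have hi : Integrable fun t : ℝ ↦ exp (-t ^ 2) := by
    simpa using integrable_exp_neg_mul_sq one_pos
  have h1 := intervalIntegral.integral_interval_add_Ioi (a := 0) (b := T)
    (f := fun t : ℝ ↦ exp (-t ^ 2)) (μ := volume) hi.integrableOn hi.integrableOn
  have h2 : ∫ t in Set.Ioi (0 : ℝ), exp (-t ^ 2) = √π / 2 := by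
    simpa using integral_gaussian_Ioi 1
  have hs : Integrable fun t : ℝ ↦ exp (-T ^ 2) * exp (-(t - T) ^ 2) :=
    (hi.comp_sub_right T).const_mul _
  have h3 : ∫ t in Set.Ioi T, exp (-t ^ 2) ≤ √π * exp (-T ^ 2) := by
    calc ∫ t in Set.Ioi T, exp (-t ^ 2)
        ≤ ∫ t in Set.Ioi T, exp (-T ^ 2) * exp (-(t - T) ^ 2) := by
          refine setIntegral_mono_on hi.integrableOn hs.integrableOn measurableSet_Ioi
            fun t ht ↦ ?_
          rw [← exp_add, exp_le_exp]
          have : T < t := ht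
          nlinarith
      _ ≤ ∫ t, exp (-T ^ 2) * exp (-(t - T) ^ 2) :=
          setIntegral_le_integral hs (Eventually.of_forall fun t ↦ by simp only; positivity)
      _ = √π * exp (-T ^ 2) := by
          rw [integral_const_mul, integral_sub_right_eq_self (fun t ↦ exp (-t ^ 2)) T]
          have := integral_gaussian 1
          simp only [neg_mul, one_mul, div_one] at this
          rw [this, mul_comm]
  have h4 : 0 ≤ ∫ t in Set.Ioi T, exp (-t ^ 2) := integral_nonneg fun t ↦ (exp_pos _).le
  rw [abs_le]
  constructor <;> linarith

lemma exists_primitive_exp_sq : ∃ Ξ : ℂ → ℂ, ∀ z, HasDerivAt Ξ (Complex.exp (z ^ 2)) z := by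
  obtain ⟨g, hg⟩ := Differentiable.isExactOn_univ (f := fun z : ℂ ↦ Complex.exp (z ^ 2))
    (by fun_prop)
  exact ⟨g, fun z ↦ hg z (Set.mem_univ z)⟩

lemma primitive_sub_horizontal {Ξ : ℂ → ℂ} (hΞ : ∀ z, HasDerivAt Ξ (Complex.exp (z ^ 2)) z)
    {r T : ℝ} (hr : 0 ≤ r) :
    ‖Ξ (r + T * Complex.I) - Ξ (T * Complex.I)‖ ≤ r * exp (r ^ 2 - T ^ 2) := by
  have hd : ∀ u ∈ Set.uIcc 0 r, HasDerivAt (fun u : ℝ ↦ Ξ (u + T * Complex.I))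
      (Complex.exp ((u + T * Complex.I) ^ 2)) u := fun u _ ↦ by
    have h1 : HasDerivAt (fun z : ℂ ↦ Ξ (z + T * Complex.I))
        (Complex.exp ((u + T * Complex.I) ^ 2)) (u : ℂ) :=
      (hΞ _).comp_add_const (u : ℂ) (T * Complex.I)
    exact h1.comp_ofReal
  have h := intervalIntegral.integral_eq_sub_of_hasDerivAt hd
    (Continuous.intervalIntegrable (by fun_prop) _ _)
  simp only [Complex.ofReal_zero, zero_add] at h
  rw [← h]
  have := intervalIntegral.norm_integral_le_of_norm_le_const (a := 0) (b := r)
    (C := exp (r ^ 2 - T ^ 2)) (f := fun u : ℝ ↦ Complex.exp ((u + T * Complex.I) ^ 2))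
    (fun u hu ↦ by
      rw [Set.uIoc_of_le hr] at hu
      rw [Complex.norm_exp, exp_le_exp]
      have : ((u + T * Complex.I) ^ 2).re = u ^ 2 - T ^ 2 := by
        simp [pow_two]
      rw [this]
      have := hu.1.le
      have := hu.2
      gcongr)
  rw [sub_zero, abs_of_nonneg hr] at this
  exact this.trans_eq (mul_comm _ _)

lemma primitive_sub_vertical {Ξ : ℂ → ℂ} (hΞ : ∀ z, HasDerivAt Ξ (Complex.exp (z ^ 2)) z)
    (T : ℝ) :
    Ξ (T * Complex.I) - Ξ 0 = Complex.I * ((∫ t in (0 : ℝ)..T, exp (-t ^ 2) : ℝ) : ℂ) := by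
  have hd : ∀ u ∈ Set.uIcc 0 T, HasDerivAt (fun u : ℝ ↦ Ξ (u * Complex.I))
      (Complex.I * (exp (-u ^ 2) : ℝ)) u := fun u _ ↦ by
    have h1 : HasDerivAt (fun z : ℂ ↦ Ξ (z * Complex.I))
        (Complex.exp ((u * Complex.I) ^ 2) * (1 * Complex.I)) (u : ℂ) :=
      (hΞ _).comp (u : ℂ) ((hasDerivAt_id (u : ℂ)).mul_const Complex.I)
    convert h1.comp_ofReal using 1
    rw [mul_pow, Complex.I_sq]
    push_cast
    rw [mul_comm]
    simp
  have h := intervalIntegral.integral_eq_sub_of_hasDerivAt hd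
    (Continuous.intervalIntegrable (by fun_prop) _ _)
  simp only [Complex.ofReal_zero, zero_mul] at h
  rw [← h, intervalIntegral.integral_const_mul, intervalIntegral.integral_ofReal]

lemma primitive_conj_sub {Ξ : ℂ → ℂ} (hΞ : ∀ z, HasDerivAt Ξ (Complex.exp (z ^ 2)) z)
    {r T : ℝ} (hr : 0 ≤ r) (hT : 0 ≤ T) :
    ‖Ξ (r - T * Complex.I) - Ξ (r + T * Complex.I) + Complex.I * √π‖ ≤
      2 * r * exp (r ^ 2 - T ^ 2) + 2 * √π * exp (-T ^ 2) := by
  have h1 := primitive_sub_horizontal hΞ (T := T) hr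
  have h2 := primitive_sub_horizontal hΞ (T := -T) hr
  have h3 := primitive_sub_vertical hΞ T
  have h4 := primitive_sub_vertical hΞ (-T)
  have h5 := abs_integral_gaussian_sub_le hT
  have h6 : ∫ t in (0 : ℝ)..(-T), exp (-t ^ 2) = -∫ t in (0 : ℝ)..T, exp (-t ^ 2) := by
    have := intervalIntegral.integral_comp_neg (a := 0) (b := T) (fun t : ℝ ↦ exp (-t ^ 2))
    simp only [neg_sq, neg_zero] at this
    rw [this, intervalIntegral.integral_symm]
  rw [h6] at h4
  set G := ∫ t in (0 : ℝ)..T, exp (-t ^ 2)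
  rw [neg_sq] at h2
  have key : Ξ (r - T * Complex.I) - Ξ (r + T * Complex.I) + Complex.I * √π =
      (Ξ (r + (-T : ℝ) * Complex.I) - Ξ ((-T : ℝ) * Complex.I)) -
      (Ξ (r + T * Complex.I) - Ξ (T * Complex.I)) -
      Complex.I * ((2 * G - √π : ℝ) : ℂ) := by
    have e : (r - T * Complex.I : ℂ) = r + (-T : ℝ) * Complex.I := by push_cast; ring
    rw [e]
    push_cast at h4 h3 ⊢
    linear_combination h4 - h3
  rw [key]
  refine (norm_sub_le _ _).trans ?_
  have h7 : ‖Complex.I * ((2 * G - √π : ℝ) : ℂ)‖ ≤ 2 * √π * exp (-T ^ 2) := by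
    rw [norm_mul, Complex.norm_I, one_mul, Complex.norm_real]
    exact h5
  have h8 := norm_sub_le (Ξ (r + (-T : ℝ) * Complex.I) - Ξ ((-T : ℝ) * Complex.I))
      (Ξ (r + T * Complex.I) - Ξ (T * Complex.I))
  linarith

/-- The branch of the square root on the right half plane. -/
noncomputable def csq (w : ℂ) : ℂ := Complex.exp (Complex.log w / 2)

lemma csq_ne_zero (w : ℂ) : csq w ≠ 0 := Complex.exp_ne_zero _

lemma csq_sq {w : ℂ} (hw : w ≠ 0) : csq w ^ 2 = w := by
  rw [csq, ← Complex.exp_nat_mul]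
  convert Complex.exp_log hw using 2
  push_cast; ring

lemma csq_conj {w : ℂ} (hw : 0 < w.re) :
    csq (starRingEnd ℂ w) = starRingEnd ℂ (csq w) := by
  have harg : w.arg ≠ π := by
    intro h
    have := Complex.arg_eq_pi_iff.1 h
    linarith [this.1]
  rw [csq, csq, ← Complex.exp_conj, Complex.log_conj _ harg, map_div₀, map_ofNat]

lemma csq_re_pos {w : ℂ} (hw : 0 < w.re) : 0 < (csq w).re := by
  rw [csq, Complex.exp_re]
  refine mul_pos (exp_pos _) (Real.cos_pos_of_mem_Ioo ?_)
  have h := Complex.abs_arg_lt_pi_div_two_iff.2 (Or.inl hw)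
  have := abs_lt.1 h
  have hpi := pi_pos
  have e : (Complex.log w / 2).im = w.arg / 2 := by
    rw [show (2 : ℂ) = ((2 : ℝ) : ℂ) by norm_num, Complex.div_ofReal_im, Complex.log_im]
  rw [e]
  constructor <;> linarith [this.1, this.2]

lemma hasDerivAt_csq {w : ℂ} (hw : 0 < w.re) : HasDerivAt csq (1 / (2 * csq w)) w := by
  have hw0 : w ≠ 0 := by rintro rfl; simp at hw
  have hs : w ∈ Complex.slitPlane := Or.inl hw
  have h := ((Complex.hasDerivAt_log hs).div_const 2).cexp
  refine h.congr_deriv ?_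
  change csq w * _ = _
  have := csq_sq hw0
  have hc := csq_ne_zero w
  field_simp
  exact this

/-- A primitive of `√w * exp (k² (L² w + 1 / w))`, given a primitive `Ξ` of `exp (z²)`. -/
noncomputable def kernelPrimitive (Ξ : ℂ → ℂ) (k L w : ℂ) : ℂ :=
  1 / (k * L) ^ 2 * (csq w * Complex.exp (k ^ 2 * (L ^ 2 * w + 1 / w)) +
    (k - 1 / (2 * k * L)) * Complex.exp (2 * k ^ 2 * L) * Ξ (k * (L * csq w - 1 / csq w)) -
    (k + 1 / (2 * k * L)) * Complex.exp (-(2 * k ^ 2 * L)) * Ξ (k * (L * csq w + 1 / csq w)))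

lemma hasDerivAt_kernelPrimitive {Ξ : ℂ → ℂ} (hΞ : ∀ z, HasDerivAt Ξ (Complex.exp (z ^ 2)) z)
    {k L w : ℂ} (hk : k ≠ 0) (hL : L ≠ 0) (hw : 0 < w.re) :
    HasDerivAt (kernelPrimitive Ξ k L) (csq w * Complex.exp (k ^ 2 * (L ^ 2 * w + 1 / w))) w := by
  have hw0 : w ≠ 0 := by rintro rfl; simp at hw
  have hs := hasDerivAt_csq hw
  have hs0 := csq_ne_zero w
  have hss := csq_sq hw0
  have hinv : HasDerivAt (fun w ↦ 1 / csq w) (-(1 / (2 * csq w)) / csq w ^ 2) w := by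
    simpa only [one_div] using! hs.inv hs0
  have hE : HasDerivAt (fun w : ℂ ↦ Complex.exp (k ^ 2 * (L ^ 2 * w + 1 / w)))
      (Complex.exp (k ^ 2 * (L ^ 2 * w + 1 / w)) * (k ^ 2 * (L ^ 2 * 1 + -1 / w ^ 2))) w := by
    have h1 : HasDerivAt (fun w : ℂ ↦ 1 / w) (-1 / w ^ 2) w := by
      simpa only [one_div, id] using! (hasDerivAt_id w).inv hw0
    exact ((((hasDerivAt_id w).const_mul (L ^ 2)).add h1).const_mul (k ^ 2)).cexp
  have h1 := (hΞ (k * (L * csq w - 1 / csq w))).comp w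
    (((hs.const_mul L).sub hinv).const_mul k)
  have h2 := (hΞ (k * (L * csq w + 1 / csq w))).comp w
    (((hs.const_mul L).add hinv).const_mul k)
  have h3 := ((((hs.mul hE).add (h1.const_mul
    ((k - 1 / (2 * k * L)) * Complex.exp (2 * k ^ 2 * L)))).sub (h2.const_mul
    ((k + 1 / (2 * k * L)) * Complex.exp (-(2 * k ^ 2 * L))))).const_mul (1 / (k * L) ^ 2))
  refine h3.congr_deriv ?_
  have e1 : Complex.exp (2 * k ^ 2 * L) * Complex.exp ((k * (L * csq w - 1 / csq w)) ^ 2) =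
      Complex.exp (k ^ 2 * (L ^ 2 * w + 1 / w)) := by
    rw [← Complex.exp_add]
    congr 1
    nth_rw 3 [← hss]
    nth_rw 4 [← hss]
    field_simp
    ring
  have e2 : Complex.exp (-(2 * k ^ 2 * L)) * Complex.exp ((k * (L * csq w + 1 / csq w)) ^ 2) =
      Complex.exp (k ^ 2 * (L ^ 2 * w + 1 / w)) := by
    rw [← Complex.exp_add]
    congr 1
    nth_rw 3 [← hss]
    nth_rw 4 [← hss]
    field_simp
    ring
  set E := Complex.exp (k ^ 2 * (L ^ 2 * w + 1 / w))
  set s := csq w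
  rw [mul_assoc (k - 1 / (2 * k * L)), mul_assoc (k + 1 / (2 * k * L)),
    ← mul_assoc (Complex.exp (2 * k ^ 2 * L)), ← mul_assoc (Complex.exp (-(2 * k ^ 2 * L))),
    e1, e2, ← hss]
  field_simp
  ring

lemma sqrt_I_mul {w : ℂ} (hw : 0 < w.re) :
    Complex.sqrt (Complex.I * w) = Complex.sqrt Complex.I * csq w := by
  have hw0 : w ≠ 0 := by rintro rfl; simp at hw
  have hI0 := Complex.I_ne_zero
  have harg := abs_lt.1 (Complex.abs_arg_lt_pi_div_two_iff.2 (Or.inl hw))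
  have hpi := pi_pos
  have hlog : Complex.log (Complex.I * w) = Complex.log Complex.I + Complex.log w := by
    refine Complex.log_mul hI0 hw0 ?_
    rw [Complex.arg_I]
    constructor <;> linarith [harg.1, harg.2]
  rw [Complex.sqrt, Complex.sqrt, Complex.cpow_def_of_ne_zero (mul_ne_zero hI0 hw0),
    Complex.cpow_def_of_ne_zero hI0, csq, ← Complex.exp_add, hlog]
  congr 1
  ring

/-- The modular transformation of the Dedekind eta function, in the variable `w = τ / i`. -/
lemma eta_I_mul_inv {w : ℂ} (hw : 0 < w.re) :
    (ModularForm.eta (Complex.I * w))⁻¹ = csq w * Complex.exp (π / (12 * w)) *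
      (euler (Complex.exp (2 * π * Complex.I * (Complex.I / w))))⁻¹ := by
  have hw0 : w ≠ 0 := by rintro rfl; simp at hw
  have hI0 := Complex.I_ne_zero
  have h := ModularForm.eta_comp_eq_csqrt_I_inv (x := Complex.I * w) (by
    change 0 < (Complex.I * w).im
    simpa using hw)
  simp only [Function.comp, Pi.smul_apply, Pi.mul_apply, smul_eq_mul] at h
  rw [sqrt_I_mul hw] at h
  have hs : Complex.sqrt Complex.I ≠ 0 := by
    rw [Complex.sqrt, Complex.cpow_def_of_ne_zero hI0]
    exact Complex.exp_ne_zero _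
  rw [← mul_assoc, ← mul_assoc, inv_mul_cancel₀ hs, one_mul] at h
  have e : -1 / (Complex.I * w) = Complex.I / w := by
    field_simp
    rw [Complex.I_sq]
  rw [e] at h
  have h2 : ModularForm.eta (Complex.I * w) =
      (csq w)⁻¹ * ModularForm.eta (Complex.I / w) := by
    rw [h, ← mul_assoc, inv_mul_cancel₀ (csq_ne_zero w), one_mul]
  rw [h2, mul_inv, inv_inv, eta_eq, mul_inv, ← Complex.exp_neg, ← mul_assoc]
  congr 3
  field_simp
  rw [Complex.I_sq]
  ring

lemma norm_euler_inv_sub_one_le {q : ℂ} (hq : ‖q‖ ≤ 1 / 20) :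
    ‖(euler q)⁻¹ - 1‖ ≤ 8 * ‖q‖ := by
  have h0 := norm_nonneg q
  have h1 : ‖euler q - 1‖ ≤ 4 * ‖q‖ := by
    refine (norm_euler_sub_one_le (by linarith)).trans ?_
    have h2 : ‖q‖ / (1 - ‖q‖) ≤ 2 * ‖q‖ := by
      rw [div_le_iff₀ (by linarith)]
      nlinarith
    have h3 : 0 ≤ ‖q‖ / (1 - ‖q‖) := div_nonneg h0 (by linarith)
    have h4 := Real.abs_exp_sub_one_le (x := ‖q‖ / (1 - ‖q‖)) (by rw [abs_of_nonneg h3]; linarith)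
    rw [abs_of_nonneg h3] at h4
    linarith [le_abs_self (exp (‖q‖ / (1 - ‖q‖)) - 1)]
  have h5 : (4 / 5 : ℝ) ≤ ‖euler q‖ := by
    have := norm_sub_norm_le (1 : ℂ) (euler q)
    rw [norm_one, norm_sub_rev] at this
    linarith
  have hne : euler q ≠ 0 := by
    intro h
    rw [h, norm_zero] at h5
    linarith
  have : (euler q)⁻¹ - 1 = (1 - euler q) / euler q := by field_simp
  rw [this, norm_div, norm_sub_rev, div_le_iff₀ (by linarith)]
  nlinarith

lemma integral_kernel_eq {Ξ : ℂ → ℂ} (hΞ : ∀ z, HasDerivAt Ξ (Complex.exp (z ^ 2)) z)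
    {k L : ℂ} {y : ℝ} (hk : k ≠ 0) (hL : L ≠ 0) (hy : 0 < y) (X : ℝ) :
    ∫ x in (-X)..X, csq (y - x * Complex.I) *
        Complex.exp (k ^ 2 * (L ^ 2 * (y - x * Complex.I) + 1 / (y - x * Complex.I))) =
      Complex.I * (kernelPrimitive Ξ k L (y - X * Complex.I) -
        kernelPrimitive Ξ k L (y + X * Complex.I)) := by
  have hd : ∀ x ∈ Set.uIcc (-X) X, HasDerivAt
      (fun x : ℝ ↦ Complex.I * kernelPrimitive Ξ k L (y - x * Complex.I))
      (csq (y - x * Complex.I) *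
        Complex.exp (k ^ 2 * (L ^ 2 * (y - x * Complex.I) + 1 / (y - x * Complex.I)))) x := by
    intro x _
    have h1 := hasDerivAt_kernelPrimitive hΞ hk hL (w := y - x * Complex.I) (by simpa using hy)
    have h2 : HasDerivAt (fun z : ℂ ↦ (y : ℂ) - z * Complex.I) (-(1 * Complex.I)) (x : ℂ) :=
      ((hasDerivAt_id (x : ℂ)).mul_const Complex.I).const_sub _
    have h3 := ((h1.comp (x : ℂ) h2).const_mul Complex.I).comp_ofReal
    refine h3.congr_deriv ?_
    linear_combination (-(csq (y - x * Complex.I) *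
        Complex.exp (k ^ 2 * (L ^ 2 * (y - x * Complex.I) + 1 / (y - x * Complex.I))))) *
        Complex.I_sq
  rw [intervalIntegral.integral_eq_sub_of_hasDerivAt hd]
  · push_cast
    rw [neg_mul, sub_neg_eq_add, mul_sub]
  · refine ContinuousOn.intervalIntegrable fun x _ ↦ ContinuousAt.continuousWithinAt ?_
    have hre : 0 < ((y : ℂ) - x * Complex.I).re := by simpa using hy
    have h0 : ((y : ℂ) - x * Complex.I) ≠ 0 := by
      intro h
      rw [h] at hre
      simp at hre
    have h1 : ContinuousAt (fun x : ℝ ↦ csq (y - x * Complex.I)) x :=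
      ContinuousAt.comp (f := fun x : ℝ ↦ (y : ℂ) - x * Complex.I) (g := csq)
        (hasDerivAt_csq hre).continuousAt (by fun_prop)
    refine h1.mul ?_
    fun_prop (disch := exact h0)

/-- The difference of the primitive at conjugate endpoints, split into its main term and the
error terms controlled by `primitive_conj_sub`. -/
lemma kernelPrimitive_sub_conj {Ξ : ℂ → ℂ} {k L r T ρ U : ℝ} {w : ℂ}
    (hw : 0 < w.re)
    (h1 : k * (L * csq w - 1 / csq w) = r - T * Complex.I)
    (h2 : k * (L * csq w + 1 / csq w) = ρ - U * Complex.I) :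
    Complex.I * (kernelPrimitive Ξ k L w - kernelPrimitive Ξ k L (starRingEnd ℂ w)) =
      ((1 / (k * L) ^ 2 * ((k - 1 / (2 * k * L)) * exp (2 * k ^ 2 * L) * √π) : ℝ) : ℂ) +
      ((1 / (k * L) ^ 2 : ℝ) : ℂ) * Complex.I * (
        (csq w * Complex.exp (k ^ 2 * (L ^ 2 * w + 1 / w)) -
          starRingEnd ℂ (csq w * Complex.exp (k ^ 2 * (L ^ 2 * w + 1 / w)))) +
        (((k - 1 / (2 * k * L)) * exp (2 * k ^ 2 * L) : ℝ) : ℂ) *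
          (Ξ (r - T * Complex.I) - Ξ (r + T * Complex.I) + Complex.I * √π) -
        (((k + 1 / (2 * k * L)) * exp (-(2 * k ^ 2 * L)) : ℝ) : ℂ) *
          (Ξ (ρ - U * Complex.I) - Ξ (ρ + U * Complex.I))) := by
  have c1 : k * (L * csq (starRingEnd ℂ w) - 1 / csq (starRingEnd ℂ w)) =
      r + T * Complex.I := by
    have := congrArg (starRingEnd ℂ) h1
    simpa [csq_conj hw] using this
  have c2 : k * (L * csq (starRingEnd ℂ w) + 1 / csq (starRingEnd ℂ w)) =
      ρ + U * Complex.I := by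
    have := congrArg (starRingEnd ℂ) h2
    simpa [csq_conj hw] using this
  have c3 : csq (starRingEnd ℂ w) * Complex.exp
      (k ^ 2 * (L ^ 2 * (starRingEnd ℂ w) + 1 / (starRingEnd ℂ w))) =
      starRingEnd ℂ (csq w * Complex.exp (k ^ 2 * (L ^ 2 * w + 1 / w))) := by
    rw [map_mul, ← Complex.exp_conj, csq_conj hw]
    simp
  rw [kernelPrimitive, kernelPrimitive, c1, c2, c3, h1, h2]
  push_cast
  linear_combination (-(1 / ((k : ℂ) * L) ^ 2 * ((k - 1 / (2 * k * L)) *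
    Complex.exp (2 * k ^ 2 * L) * (√π : ℝ)))) * Complex.I_sq

lemma csq_coords {L X : ℝ} (hL : 1 ≤ L) (hX0 : 0 ≤ X)
    (hX : X ^ 2 + (1 / (2 * L)) ^ 2 = 2 * (1 / (2 * L))) :
    ∃ A B : ℝ, 0 < A ∧ 0 ≤ B ∧ csq ((1 / (2 * L) : ℝ) - X * Complex.I) = A - B * Complex.I ∧
      A ^ 2 - B ^ 2 = 1 / (2 * L) ∧ A ^ 2 + B ^ 2 = 1 / √L ∧
      1 / csq ((1 / (2 * L) : ℝ) - X * Complex.I) = √L * (A + B * Complex.I) := by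
  set w : ℂ := (1 / (2 * L) : ℝ) - X * Complex.I with hwdef
  have hL0 : 0 < L := by linarith
  have hre : w.re = 1 / (2 * L) := by simp [hwdef]
  have him : w.im = -X := by simp [hwdef]
  have hw : 0 < w.re := by rw [hre]; positivity
  have hw0 : w ≠ 0 := by intro h; rw [h] at hw; simp at hw
  have hA := csq_re_pos hw
  have hsq := csq_sq hw0
  set A := (csq w).re
  set B := -(csq w).im
  have hs : csq w = A - B * Complex.I := by
    apply Complex.ext <;> simp [A, B]
  have e1 : A ^ 2 - B ^ 2 = 1 / (2 * L) := by
    rw [← hre, ← hsq, pow_two (csq w), Complex.mul_re]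
    simp only [A, B]; ring
  have e2 : 2 * A * B = X := by
    have : (csq w ^ 2).im = -X := by rw [hsq, him]
    rw [pow_two, Complex.mul_im] at this
    simp only [A, B]; linarith
  have hB : 0 ≤ B := by
    by_contra! h
    nlinarith
  have e3 : A ^ 2 + B ^ 2 = 1 / √L := by
    have h1 : (A ^ 2 + B ^ 2) ^ 2 = (1 / √L) ^ 2 := by
      rw [div_pow, sq_sqrt hL0.le, one_pow]
      have : (A ^ 2 + B ^ 2) ^ 2 = (A ^ 2 - B ^ 2) ^ 2 + (2 * A * B) ^ 2 := by ring
      rw [this, e1, e2, add_comm, hX]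
      field_simp
    have h2 : 0 < √L := sqrt_pos.2 hL0
    exact (pow_left_inj₀ (by positivity) (by positivity) two_ne_zero).1 h1
  refine ⟨A, B, hA, hB, hs, e1, e3, ?_⟩
  have h2 : 0 < √L := sqrt_pos.2 hL0
  rw [div_eq_iff (csq_ne_zero w), hs]
  have h3 : ((√L : ℝ) : ℂ) * ((A ^ 2 + B ^ 2 : ℝ) : ℂ) = 1 := by
    rw [e3, ← Complex.ofReal_mul, mul_one_div_cancel h2.ne', Complex.ofReal_one]
  push_cast at h3
  linear_combination (-1 : ℂ) * h3 + (√L : ℝ) * B ^ 2 * Complex.I_sq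

set_option maxHeartbeats 1000000 in
lemma norm_integral_kernel_sub_le {L X : ℝ} (hL : 154 ≤ L) (hX0 : 0 ≤ X)
    (hX : X ^ 2 + (1 / (2 * L)) ^ 2 = 2 * (1 / (2 * L))) :
    ‖(∫ x in (-X)..X, csq ((1 / (2 * L) : ℝ) - x * Complex.I) *
        Complex.exp ((√(π / 12) : ℝ) ^ 2 * ((L : ℂ) ^ 2 * ((1 / (2 * L) : ℝ) - x * Complex.I) +
          1 / ((1 / (2 * L) : ℝ) - x * Complex.I)))) -
      (√12 / L ^ 2 * (1 - 6 / (π * L)) * exp (π * L / 6) : ℝ)‖ ≤ exp (π * L / 24) := by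
  obtain ⟨Ξ, hΞ⟩ := exists_primitive_exp_sq
  obtain ⟨A, B, hA, hB, hs, hAB, hAB', hsi⟩ := csq_coords (by linarith) hX0 hX
  have hL0 : 0 < L := by linarith
  have hpi := pi_pos
  set k := √(π / 12) with hk
  have hk2 : k ^ 2 = π / 12 := sq_sqrt (by positivity)
  have hk0 : 0 < k := sqrt_pos.2 (by positivity)
  have hy : 0 < 1 / (2 * L) := by positivity
  rw [integral_kernel_eq hΞ (k := (k : ℂ)) (L := (L : ℂ))
    (by exact_mod_cast hk0.ne') (by exact_mod_cast hL0.ne') hy X]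
  set w : ℂ := (1 / (2 * L) : ℝ) - X * Complex.I with hw
  have hwre : 0 < w.re := by simpa [hw] using hy
  have hconj : ((1 / (2 * L) : ℝ) + X * Complex.I : ℂ) = starRingEnd ℂ w := by
    rw [hw, map_sub, map_mul, Complex.conj_ofReal, Complex.conj_ofReal, Complex.conj_I]
    ring
  set S := √L with hS
  have hS2 : S ^ 2 = L := sq_sqrt hL0.le
  have hS0 : 0 < S := sqrt_pos.2 hL0
  have hS1 : 1 ≤ S := one_le_sqrt.2 (by linarith)
  have hSL : S ≤ L := by nlinarith only [hS1, hS2]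
  rw [hconj, kernelPrimitive_sub_conj (Ξ := Ξ) (r := k * ((L - S) * A)) (T := k * ((L + S) * B))
    (ρ := k * ((L + S) * A)) (U := k * ((L - S) * B)) hwre
    (by rw [hsi, hs]; push_cast; ring) (by rw [hsi, hs]; push_cast; ring)]
  set r := k * ((L - S) * A)
  set T := k * ((L + S) * B)
  set ρ := k * ((L + S) * A)
  set U := k * ((L - S) * B)
  have hr : 0 ≤ r := mul_nonneg hk0.le (mul_nonneg (by linarith) hA.le)
  have hT : 0 ≤ T := mul_nonneg hk0.le (mul_nonneg (by linarith) hB)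
  have hρ : 0 ≤ ρ := mul_nonneg hk0.le (mul_nonneg (by linarith) hA.le)
  have hU : 0 ≤ U := mul_nonneg hk0.le (mul_nonneg (by linarith) hB)
  have hAB2 : S * (A ^ 2 + B ^ 2) = 1 := by rw [hAB']; field_simp
  have hAB1 : 2 * L * (A ^ 2 - B ^ 2) = 1 := by rw [hAB]; field_simp
  have hrT : r ^ 2 - T ^ 2 = π / 12 * ((1 - 3 * L) / 2) := by
    rw [← hk2]
    simp only [r, T]
    have : (k * ((L - S) * A)) ^ 2 - (k * ((L + S) * B)) ^ 2 =
      k ^ 2 * ((L ^ 2 + S ^ 2) * (A ^ 2 - B ^ 2) - 2 * L * (S * (A ^ 2 + B ^ 2))) := by ring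
    rw [this, hAB2, hAB, hS2]
    field_simp
    ring
  have hρU : ρ ^ 2 - U ^ 2 = π / 12 * ((1 + 5 * L) / 2) := by
    rw [← hk2]
    simp only [ρ, U]
    have : (k * ((L + S) * A)) ^ 2 - (k * ((L - S) * B)) ^ 2 =
      k ^ 2 * ((L ^ 2 + S ^ 2) * (A ^ 2 - B ^ 2) + 2 * L * (S * (A ^ 2 + B ^ 2))) := by ring
    rw [this, hAB2, hAB, hS2]
    field_simp
    ring
  set E := exp (π * (L + 1) / 24) with hE
  have hE0 : 0 < E := exp_pos _
  have hmain : 1 / (k * L) ^ 2 * ((k - 1 / (2 * k * L)) * exp (2 * k ^ 2 * L) * √π) =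
      √12 / L ^ 2 * (1 - 6 / (π * L)) * exp (π * L / 6) := by
    have h1 : √π = k * √12 := by
      rw [hk, ← sqrt_mul (by positivity)]
      congr 1
      ring
    have h2 : k - 1 / (2 * k * L) = k * (1 - 6 / (π * L)) := by
      have : π = 12 * k ^ 2 := by rw [hk2]; ring
      rw [this]
      field_simp
      ring
    rw [h1, h2, hk2]
    have h3 : 2 * (π / 12) * L = π * L / 6 := by ring
    rw [h3]
    field_simp
  rw [hmain, add_sub_cancel_left]
  have hw0 : w ≠ 0 := by intro h; rw [h] at hwre; simp at hwre
  have hnormK : ‖csq w * Complex.exp (k ^ 2 * (L ^ 2 * w + 1 / w))‖ ≤ E := by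
    have h1 : ‖csq w‖ ≤ 1 := by
      have : ‖csq w‖ ^ 2 = A ^ 2 + B ^ 2 := by
        rw [hs, ← Complex.normSq_eq_norm_sq, Complex.normSq_apply]
        simp
        ring
      have h2 : A ^ 2 + B ^ 2 ≤ 1 := by nlinarith only [hAB2, hS1, sq_nonneg A, sq_nonneg B]
      exact (sq_le_one_iff₀ (norm_nonneg _)).1 (this.trans_le h2)
    have h2 : (((k : ℝ) : ℂ) ^ 2 * ((L : ℂ) ^ 2 * w + 1 / w)).re = π * (L + 1) / 24 := by
      have e1 : 1 / w = ((L : ℝ) : ℂ) * (A + B * Complex.I) ^ 2 := by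
        have : 1 / w = (1 / csq w) ^ 2 := by rw [div_pow, csq_sq hw0, one_pow]
        rw [this, hsi, mul_pow, ← hS2]
        push_cast
        ring
      have e2 : (1 / w).re = 1 / 2 := by
        rw [e1, Complex.re_ofReal_mul, pow_two, Complex.mul_re]
        simp
        linarith
      have e3 : w.re = 1 / (2 * L) := by simp [hw]
      rw [← Complex.ofReal_pow, Complex.re_ofReal_mul, Complex.add_re, e2, ← Complex.ofReal_pow,
        Complex.re_ofReal_mul, e3, hk2]
      field_simp
      norm_num
    rw [norm_mul, Complex.norm_exp, h2]
    exact mul_le_of_le_one_left hE0.le h1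
  have hφ := primitive_conj_sub hΞ hr hT
  have hψ := primitive_conj_sub hΞ hρ hU
  have hA1 : A ≤ 1 := by nlinarith only [hAB2, hS1, hA, sq_nonneg B]
  have hrL : r ≤ k * L := mul_le_mul_of_nonneg_left (by nlinarith only [hA1, hA, hS0, hSL]) hk0.le
  have hρL : ρ ≤ 2 * (k * L) := by
    have : (L + S) * A ≤ 2 * L := by nlinarith only [hA1, hA, hS0, hSL]
    have := mul_le_mul_of_nonneg_left this hk0.le
    simp only [ρ]
    linarith
  have hpi0 : 0 < √π := sqrt_pos.2 hpi
  have hkpi : k * √π ≤ 1 := by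
    have h1 : (k * √π) ^ 2 ≤ 1 := by
      rw [mul_pow, hk2, sq_sqrt hpi.le]
      nlinarith only [pi_lt_d2, hpi]
    exact (sq_le_one_iff₀ (by positivity)).1 h1
  have hinv : 1 / (2 * k * L) ≤ k := by
    rw [div_le_iff₀ (by positivity)]
    have : k * (2 * k * L) = π * L / 6 := by
      rw [show k * (2 * k * L) = 2 * k ^ 2 * L by ring, hk2]; ring
    rw [this]
    nlinarith only [pi_gt_three, hL]
  have hinv0 : 0 < 1 / (2 * k * L) := by positivity
  have hEr : exp (2 * k ^ 2 * L) * exp (r ^ 2 - T ^ 2) = E := by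
    rw [← exp_add, hE, hrT, hk2]; congr 1; ring
  have hEρ : exp (-(2 * k ^ 2 * L)) * exp (ρ ^ 2 - U ^ 2) = E := by
    rw [← exp_add, hE, hρU, hk2]; congr 1; ring
  have hT2 : exp (-T ^ 2) ≤ exp (r ^ 2 - T ^ 2) := exp_le_exp.2 (by linarith only [sq_nonneg r])
  have hU2 : exp (-U ^ 2) ≤ exp (ρ ^ 2 - U ^ 2) := exp_le_exp.2 (by linarith only [sq_nonneg ρ])
  have hE1 : exp (-(2 * k ^ 2 * L)) ≤ E := by
    rw [hE, exp_le_exp, hk2]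
    have : 0 < π * L := by positivity
    linarith
  have n2 : ‖(((k - 1 / (2 * k * L)) * exp (2 * k ^ 2 * L) : ℝ) : ℂ) *
      (Ξ (r - T * Complex.I) - Ξ (r + T * Complex.I) + Complex.I * √π)‖ ≤
      E * (2 * (k ^ 2 * L) + 2 * (k * √π)) := by
    rw [norm_mul, Complex.norm_real, norm_eq_abs, abs_of_nonneg
      (mul_nonneg (by linarith) (exp_pos _).le)]
    calc (k - 1 / (2 * k * L)) * exp (2 * k ^ 2 * L) * _
        ≤ k * exp (2 * k ^ 2 * L) * (2 * (k * L) * exp (r ^ 2 - T ^ 2) +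
            2 * √π * exp (r ^ 2 - T ^ 2)) := by
          gcongr
          · linarith
          · exact hφ.trans (by gcongr)
      _ = (exp (2 * k ^ 2 * L) * exp (r ^ 2 - T ^ 2)) * (2 * (k ^ 2 * L) + 2 * (k * √π)) := by
          ring
      _ = _ := by rw [hEr]
  have n3 : ‖(((k + 1 / (2 * k * L)) * exp (-(2 * k ^ 2 * L)) : ℝ) : ℂ) *
      (Ξ (ρ - U * Complex.I) - Ξ (ρ + U * Complex.I))‖ ≤
      E * (8 * (k ^ 2 * L) + 6 * (k * √π)) := by
    have h1 : ‖Ξ (ρ - U * Complex.I) - Ξ (ρ + U * Complex.I)‖ ≤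
        4 * (k * L) * exp (ρ ^ 2 - U ^ 2) + 2 * √π * exp (ρ ^ 2 - U ^ 2) + √π := by
      have e : Ξ (ρ - U * Complex.I) - Ξ (ρ + U * Complex.I) =
          (Ξ (ρ - U * Complex.I) - Ξ (ρ + U * Complex.I) + Complex.I * √π) -
            Complex.I * √π := by ring
      rw [e]
      refine (norm_sub_le _ _).trans ?_
      have h2 : ‖Complex.I * ((√π : ℝ) : ℂ)‖ = √π := by
        rw [norm_mul, Complex.norm_I, one_mul, Complex.norm_real, norm_of_nonneg hpi0.le]
      rw [h2]
      have h3 : 2 * ρ * exp (ρ ^ 2 - U ^ 2) ≤ 4 * (k * L) * exp (ρ ^ 2 - U ^ 2) :=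
        mul_le_mul_of_nonneg_right (by linarith) (exp_pos _).le
      have h4 : 2 * √π * exp (-U ^ 2) ≤ 2 * √π * exp (ρ ^ 2 - U ^ 2) := by gcongr
      linarith
    rw [norm_mul, Complex.norm_real, norm_eq_abs, abs_of_nonneg
      (mul_nonneg (by linarith) (exp_pos _).le)]
    calc (k + 1 / (2 * k * L)) * exp (-(2 * k ^ 2 * L)) * _
        ≤ 2 * k * exp (-(2 * k ^ 2 * L)) * (4 * (k * L) * exp (ρ ^ 2 - U ^ 2) +
            2 * √π * exp (ρ ^ 2 - U ^ 2) + √π) := by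
          gcongr
          linarith
      _ = (exp (-(2 * k ^ 2 * L)) * exp (ρ ^ 2 - U ^ 2)) *
            (8 * (k ^ 2 * L) + 4 * (k * √π)) + exp (-(2 * k ^ 2 * L)) * (2 * (k * √π)) := by
          ring
      _ ≤ E * (8 * (k ^ 2 * L) + 4 * (k * √π)) + E * (2 * (k * √π)) := by
          rw [hEρ]; gcongr
      _ = _ := by ring
  rw [norm_mul, norm_mul, Complex.norm_I, mul_one, Complex.norm_real, norm_of_nonneg
    (by positivity)]
  have n4 : ‖(csq w * Complex.exp (k ^ 2 * (L ^ 2 * w + 1 / w)) -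
      starRingEnd ℂ (csq w * Complex.exp (k ^ 2 * (L ^ 2 * w + 1 / w))))‖ ≤ 2 * E := by
    refine (norm_sub_le _ _).trans ?_
    rw [Complex.norm_conj]
    linarith
  have hE2 : E ≤ 2 * exp (π * L / 24) := by
    have h1 : E = exp (π / 24) * exp (π * L / 24) := by
      rw [hE, ← exp_add]; congr 1; ring
    have h2 : exp (π / 24) ≤ 2 := by
      have h0 : 0 ≤ π / 24 := by positivity
      have := Real.abs_exp_sub_one_le (x := π / 24) (by
        rw [abs_of_nonneg h0]; linarith [pi_lt_d2])
      rw [abs_of_nonneg h0] at this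
      linarith [le_abs_self (exp (π / 24) - 1), pi_lt_d2]
    rw [h1]
    gcongr
  calc _ ≤ 1 / (k * L) ^ 2 * (2 * E + E * (2 * (k ^ 2 * L) + 2 * (k * √π)) +
          E * (8 * (k ^ 2 * L) + 6 * (k * √π))) := by
        gcongr
        exact (norm_sub_le _ _).trans (add_le_add ((norm_add_le _ _).trans
          (add_le_add n4 n2)) n3)
    _ ≤ 1 / (k * L) ^ 2 * (E * (10 * (k ^ 2 * L) + 10)) := by
        gcongr
        nlinarith only [hE0, mul_le_mul_of_nonneg_left hkpi hE0.le]
    _ ≤ 1 / 2 * E := by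
        have : 1 / (k * L) ^ 2 * (E * (10 * (k ^ 2 * L) + 10)) =
            E * (10 / L + 10 / (k ^ 2 * L ^ 2)) := by field_simp
        rw [this, mul_comm]
        gcongr
        have h1 : 10 / L ≤ 1 / 4 := by rw [div_le_iff₀ hL0]; linarith
        have h2 : 10 / (k ^ 2 * L ^ 2) ≤ 1 / 4 := by
          rw [div_le_iff₀ (by positivity), hk2]
          nlinarith only [pi_gt_three, hL]
        linarith
    _ ≤ exp (π * L / 24) := by linarith

lemma continuous_integrand (n : ℕ) {y : ℝ} (hy : 0 < y) :
    Continuous fun x : ℝ ↦ Complex.exp (-(2 * π * Complex.I * (n - 1 / 24) *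
      (x + y * Complex.I))) / ModularForm.eta (x + y * Complex.I) := by
  have hmem : ∀ x : ℝ, (x + y * Complex.I : ℂ) ∈ UpperHalfPlane.upperHalfPlaneSet := fun x ↦ by
    change 0 < (x + y * Complex.I : ℂ).im
    simpa using hy
  refine Continuous.div (by fun_prop) ?_ fun x ↦ ModularForm.eta_ne_zero (hmem x)
  refine continuous_iff_continuousAt.2 fun x ↦ ?_
  exact ContinuousAt.comp (f := fun x : ℝ ↦ (x + y * Complex.I : ℂ)) (g := ModularForm.eta)
    (ModularForm.differentiableAt_eta_of_mem_upperHalfPlaneSet (hmem x)).continuousAt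
    (by fun_prop)

lemma continuous_kernel (k L : ℂ) {y : ℝ} (hy : 0 < y) :
    Continuous fun x : ℝ ↦ csq (y - x * Complex.I) *
      Complex.exp (k ^ 2 * (L ^ 2 * (y - x * Complex.I) + 1 / (y - x * Complex.I))) := by
  refine continuous_iff_continuousAt.2 fun x ↦ ?_
  have hre : 0 < ((y : ℂ) - x * Complex.I).re := by simpa using hy
  have h0 : ((y : ℂ) - x * Complex.I) ≠ 0 := by
    intro h
    rw [h] at hre
    simp at hre
  have h1 : ContinuousAt (fun x : ℝ ↦ csq (y - x * Complex.I)) x :=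
    ContinuousAt.comp (f := fun x : ℝ ↦ (y : ℂ) - x * Complex.I) (g := csq)
      (hasDerivAt_csq hre).continuousAt (by fun_prop)
  refine h1.mul ?_
  fun_prop (disch := exact h0)

lemma norm_integral_near_sub_kernel_le {L X : ℝ} (n : ℕ) (hn : L ^ 2 = 24 * n - 1)
    (hL : 154 ≤ L) (hX0 : 0 ≤ X) (hX1 : X ≤ 1 / 2)
    (hX : X ^ 2 + (1 / (2 * L)) ^ 2 = 2 * (1 / (2 * L))) :
    ‖(∫ x in (-X)..X, Complex.exp (-(2 * π * Complex.I * (n - 1 / 24) *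
        (x + (1 / (2 * L) : ℝ) * Complex.I))) /
          ModularForm.eta (x + (1 / (2 * L) : ℝ) * Complex.I)) -
      ∫ x in (-X)..X, csq ((1 / (2 * L) : ℝ) - x * Complex.I) *
        Complex.exp ((√(π / 12) : ℝ) ^ 2 * ((L : ℂ) ^ 2 * ((1 / (2 * L) : ℝ) - x * Complex.I) +
          1 / ((1 / (2 * L) : ℝ) - x * Complex.I)))‖ ≤ 8 * exp (π * L / 24) := by
  have hL0 : 0 < L := by linarith
  have hpi := pi_pos
  set y := 1 / (2 * L) with hydef
  have hy : 0 < y := by positivity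
  rw [← intervalIntegral.integral_sub
    ((continuous_integrand n hy).intervalIntegrable _ _)
    ((continuous_kernel _ _ hy).intervalIntegrable _ _)]
  have hk2 : ((√(π / 12) : ℝ) : ℂ) ^ 2 = π / 12 := by
    rw [← Complex.ofReal_pow, sq_sqrt (by positivity)]
    push_cast
    ring
  refine (intervalIntegral.norm_integral_le_of_norm_le_const
    (C := 8 * exp (π * L / 24)) fun x hx ↦ ?_).trans ?_
  · rw [Set.uIoc_of_le (by linarith)] at hx
    have hx2 : x ^ 2 ≤ X ^ 2 := sq_le_sq' hx.1.le hx.2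
    set w : ℂ := (y : ℂ) - x * Complex.I with hw
    have hre : w.re = y := by simp [hw]
    have him : w.im = -x := by simp [hw]
    have hwre : 0 < w.re := by rw [hre]; exact hy
    have hw0 : w ≠ 0 := by intro h; rw [h] at hwre; simp at hwre
    have hτ : (x + y * Complex.I : ℂ) = Complex.I * w := by
      rw [hw]
      linear_combination (x : ℂ) * Complex.I_sq
    have hn' : ((n : ℂ) - 1 / 24) = (L : ℂ) ^ 2 / 24 := by
      have : ((n : ℝ) - 1 / 24) = L ^ 2 / 24 := by rw [hn]; ring
      have := congrArg (fun t : ℝ ↦ (t : ℂ)) this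
      push_cast at this
      exact this
    set q := Complex.exp (2 * π * Complex.I * (Complex.I / w))
    set Y := (1 / w).re with hY
    have hns : Complex.normSq w = y ^ 2 + x ^ 2 := by
      rw [Complex.normSq_apply, hre, him]; ring
    have hns0 : 0 < Complex.normSq w := Complex.normSq_pos.2 hw0
    have hYeq : Y = y / (y ^ 2 + x ^ 2) := by
      rw [hY, one_div, Complex.inv_re, hre, hns]
    have hYge : 1 / 2 ≤ Y := by
      rw [hYeq, div_le_div_iff₀ two_pos (hns ▸ hns0)]
      linarith
    have hq : ‖q‖ = exp (-(2 * π * Y)) := by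
      rw [norm_exp_two_pi_I_mul]
      have : (Complex.I / w).im = Y := by
        rw [hY, div_eq_mul_one_div]
        simp
      rw [this]
    have hq20 : ‖q‖ ≤ 1 / 20 := by
      rw [hq, exp_neg, one_div]
      refine inv_anti₀ (by norm_num) ?_
      have h1 : (3 : ℝ) ≤ 2 * π * Y := by nlinarith [pi_gt_three]
      refine le_trans ?_ (exp_le_exp.2 h1)
      have h2 : exp 3 = exp 1 ^ 3 := by rw [← exp_nat_mul]; norm_num
      rw [h2]
      have h3 : (2.718 : ℝ) ≤ exp 1 := by linarith [exp_one_gt_d9]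
      refine le_trans ?_ (pow_le_pow_left₀ (by norm_num) h3 3)
      norm_num
    have e1 : Complex.exp (-(2 * π * Complex.I * (n - 1 / 24) * (x + y * Complex.I))) /
          ModularForm.eta (x + y * Complex.I) =
        csq w * Complex.exp ((√(π / 12) : ℝ) ^ 2 * ((L : ℂ) ^ 2 * w + 1 / w)) *
          (euler q)⁻¹ := by
      rw [div_eq_mul_inv, hτ, eta_I_mul_inv hwre, hn', hk2, mul_add, Complex.exp_add]
      have h1 : -(2 * π * Complex.I * ((L : ℂ) ^ 2 / 24) * (Complex.I * w)) =
          π / 12 * ((L : ℂ) ^ 2 * w) := by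
        linear_combination (-(π * (L : ℂ) ^ 2 * w / 12)) * Complex.I_sq
      have h2 : (π / (12 * w) : ℂ) = π / 12 * (1 / w) := by field_simp
      rw [h1, h2]
      ring
    rw [e1]
    have e2 : ∀ a b : ℂ, a * b - a = a * (b - 1) := fun a b ↦ by ring
    rw [e2, norm_mul, norm_mul, Complex.norm_exp, hk2]
    have hc1 : ‖csq w‖ ≤ 1 := by
      have h1 : ‖csq w‖ ^ 2 = ‖w‖ := by rw [← norm_pow, csq_sq hw0]
      have h2 : ‖w‖ ≤ 1 := by
        have : ‖w‖ ^ 2 ≤ 1 := by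
          rw [← Complex.normSq_eq_norm_sq, hns]
          have : y ≤ 1 / 2 := by
            rw [hydef, div_le_div_iff₀ (by positivity) two_pos]; linarith
          linarith
        exact (sq_le_one_iff₀ (norm_nonneg _)).1 this
      exact (sq_le_one_iff₀ (norm_nonneg _)).1 (h1.trans_le h2)
    have e3 : ((π / 12 : ℂ) * ((L : ℂ) ^ 2 * w + 1 / w)).re = π * L / 24 + π * Y / 12 := by
      have : ((π / 12 : ℂ) * ((L : ℂ) ^ 2 * w + 1 / w)) =
          ((π / 12 : ℝ) : ℂ) * (((L ^ 2 : ℝ) : ℂ) * w + 1 / w) := by push_cast; ring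
      rw [this, Complex.re_ofReal_mul, Complex.add_re, Complex.re_ofReal_mul, hre, ← hY, hydef]
      field_simp
      ring
    rw [e3]
    calc ‖csq w‖ * exp (π * L / 24 + π * Y / 12) * ‖(euler q)⁻¹ - 1‖
        ≤ 1 * exp (π * L / 24 + π * Y / 12) * (8 * ‖q‖) := by
          gcongr
          exact norm_euler_inv_sub_one_le hq20
      _ = 8 * exp (π * L / 24 + π * Y / 12 + -(2 * π * Y)) := by
          rw [hq, exp_add _ (-(2 * π * Y))]; ring
      _ ≤ 8 * exp (π * L / 24) := by
          gcongr
          have : 0 ≤ π * Y := by positivity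
          linarith
  · rw [show X - -X = 2 * X by ring, abs_of_nonneg (by linarith)]
    have := exp_pos (π * L / 24)
    nlinarith

/-- The explicit main term of the circle method, with an error of half the exponential order. -/
lemma abs_p_sub_main_le {L : ℝ} (n : ℕ) (hn : L ^ 2 = 24 * n - 1) (hL : 154 ≤ L) :
    |p n - √12 / L ^ 2 * (1 - 6 / (π * L)) * exp (π * L / 6)| ≤
      9 * exp (π * L / 24) + 101 / 100 * exp (π * L / 24) * (1 / 4 * exp (π * L / 54) +
        10574 / 10000 * √(15 / 2) / L ^ 2 * exp (π * L / 24) +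
        1372 / 1000 / (L * √L) * exp (π * L / 30)) := by
  have hL0 : 0 < L := by linarith
  set y := 1 / (2 * L) with hydef
  have hy : 0 < y := by positivity
  have hy1 : y ≤ 1 / 16 := by
    rw [hydef, div_le_div_iff₀ (by positivity) (by norm_num)]; linarith
  set X := √(2 * y - y ^ 2)
  have hXX : X ^ 2 = 2 * y - y ^ 2 := sq_sqrt (by nlinarith)
  have hX0 : 0 ≤ X := sqrt_nonneg _
  have hX1 : X ≤ 1 / 2 := by nlinarith
  have hX : X ^ 2 + y ^ 2 = 2 * y := by linarith
  have h1 := norm_integral_far_le n hn hL hX0 hX1 hX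
  have h2 := norm_integral_near_sub_kernel_le n hn hL hX0 hX1 hX
  have h3 := norm_integral_kernel_sub_le hL hX0 hX
  have h4 := p_eq_integral n hy (-X)
  rw [show -X + 1 = 1 - X by ring, ← intervalIntegral.integral_add_adjacent_intervals
    ((continuous_integrand n hy).intervalIntegrable _ _)
    ((continuous_integrand n hy).intervalIntegrable (μ := volume) X _)] at h4
  rw [← hydef] at h1 h2 h3
  rw [← norm_eq_abs, ← Complex.norm_real, Complex.ofReal_sub, h4]
  have e : ∀ a b k m : ℂ, a + b - m = (a - k) + (k - m) + b := fun a b k m ↦ by ring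
  rw [e _ _ (∫ x in (-X)..X, csq (y - x * Complex.I) *
        Complex.exp ((√(π / 12) : ℝ) ^ 2 * ((L : ℂ) ^ 2 * (y - x * Complex.I) +
          1 / (y - x * Complex.I))))]
  refine (norm_add_le _ _).trans (add_le_add ((norm_add_le _ _).trans ?_) h1)
  linarith

end PeriodIntegral

lemma mul_exp_le_exp_mul (a x₀ x : ℝ) :
    exp (a * x₀) * (1 + a * (x - x₀)) ≤ exp (a * x) := by
  have : exp (a * x) = exp (a * x₀) * exp (a * (x - x₀)) := by
    rw [← exp_add]; congr 1; ring
  rw [this]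
  gcongr
  linarith [add_one_le_exp (a * (x - x₀))]

lemma sqrt_le_exp_div {L : ℝ} (hL : 154 ≤ L) :
    √L ≤ 2209 / 10000 * exp (π * L / 120) := by
  have h1 := mul_exp_le_exp_mul (π / 120) 154 L
  have h2 : (562 / 10 : ℝ) ≤ exp (π / 120 * 154) := by
    calc (562 / 10 : ℝ) ≤ (2.7182818283) ^ 4 * (1 + 3 / 100) := by norm_num
      _ ≤ exp 1 ^ 4 * exp (3 / 100) := by
        gcongr
        · exact exp_one_gt_d9.le
        · linarith [add_one_le_exp (3 / 100 : ℝ)]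
      _ = exp (403 / 100) := by rw [← exp_nat_mul, ← exp_add]; norm_num
      _ ≤ _ := exp_le_exp.2 (by linarith [pi_gt_d4])
  have h3 : √L ≤ 1241 / 100 * (1 + 1 / 308 * (L - 154)) := by
    rw [sqrt_le_left (by linarith)]
    nlinarith [sq_nonneg (L - 154)]
  have h4 : 562 / 10 * (1 + 26 / 1000 * (L - 154)) ≤ exp (π / 120 * L) := by
    refine le_trans ?_ h1
    have : 26 / 1000 ≤ π / 120 := by linarith [pi_gt_d4]
    have h0 : 0 ≤ L - 154 := by linarith
    gcongr
  rw [show π * L / 120 = π / 120 * L by ring]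
  linarith

lemma le_exp_div {L : ℝ} (hL : 154 ≤ L) :
    L ≤ 59 / 100 * exp (5 * π * L / 432) := by
  have h1 := mul_exp_le_exp_mul (5 * π / 432) 154 L
  have h2 : (2615 / 10 : ℝ) ≤ exp (5 * π / 432 * 154) := by
    calc (2615 / 10 : ℝ) ≤ (2.7182818283) ^ 5 * (1 + 59 / 100 + (59 / 100) ^ 2 / 2) := by norm_num
      _ ≤ exp 1 ^ 5 * exp (59 / 100) := by
        gcongr
        · exact exp_one_gt_d9.le
        · exact quadratic_le_exp_of_nonneg (by norm_num)
      _ = exp (559 / 100) := by rw [← exp_nat_mul, ← exp_add]; norm_num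
      _ ≤ _ := exp_le_exp.2 (by linarith [pi_gt_d4])
  have h4 : 2615 / 10 * (1 + 36 / 1000 * (L - 154)) ≤ exp (5 * π / 432 * L) := by
    refine le_trans ?_ h1
    have : 36 / 1000 ≤ 5 * π / 432 := by linarith [pi_gt_d4]
    have h0 : 0 ≤ L - 154 := by linarith
    gcongr
  rw [show 5 * π * L / 432 = 5 * π / 432 * L by ring]
  linarith

lemma circle_method_error_lt {L : ℝ} (hL : 154 ≤ L) :
    9 * exp (π * L / 24) + 101 / 100 * exp (π * L / 24) * (1 / 4 * exp (π * L / 54) +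
        10574 / 10000 * √(15 / 2) / L ^ 2 * exp (π * L / 24) +
        1372 / 1000 / (L * √L) * exp (π * L / 30)) <
      √12 / (L ^ 2 + 1) * exp (π * L / 12) := by
  have hL0 : 0 < L := by linarith
  have ha := sqrt_le_exp_div hL
  have hb := le_exp_div hL
  set a := exp (π * L / 120)
  set b := exp (5 * π * L / 432)
  set d := exp (π * L / 54) with hd
  set E := exp (π * L / 24) with hE
  have ha0 : 0 < a := exp_pos _
  have hb0 : 0 < b := exp_pos _
  have hd0 : 0 < d := exp_pos _
  have hE0 : 0 < E := exp_pos _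
  have hEd : E = b ^ 2 * d := by
    rw [hE, hd, ← exp_nat_mul, ← exp_add]; congr 1; push_cast; ring
  have hEa : exp (π * L / 30) * a = E := by
    rw [hE, ← exp_add]; congr 1; ring
  have hE2 : exp (π * L / 12) = E ^ 2 := by
    rw [hE, ← exp_nat_mul]; congr 1; push_cast; ring
  have hd1 : 2900 ≤ d := by
    calc (2900 : ℝ) ≤ 2.7182818283 ^ 8 := by norm_num
      _ ≤ exp 1 ^ 8 := by gcongr; exact exp_one_gt_d9.le
      _ = exp 8 := by rw [← exp_nat_mul]; norm_num
      _ ≤ d := exp_le_exp.2 (by nlinarith [pi_gt_d4])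
  set S := √L
  have hS0 : 0 < S := sqrt_pos.2 hL0
  have hSS : S * S = L := mul_self_sqrt hL0.le
  have hb2 : L ^ 2 ≤ 3481 / 10000 * b ^ 2 := by
    calc L ^ 2 ≤ (59 / 100 * b) ^ 2 := by gcongr
      _ = _ := by ring
  have t1 : 9 * E ≤ 11 / 10000 / L ^ 2 * E ^ 2 := by
    have : 9 ≤ 11 / 10000 / L ^ 2 * E := by
      rw [div_mul_eq_mul_div, le_div_iff₀ (by positivity), hEd]
      nlinarith [mul_le_mul hb2 hd1 (by norm_num) (by positivity)]
    nlinarith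
  have t2 : 1 / 4 * d ≤ 872 / 10000 / L ^ 2 * E := by
    rw [div_mul_eq_mul_div (872 / 10000), le_div_iff₀ (by positivity), hEd]
    nlinarith [mul_le_mul_of_nonneg_left hb2 hd0.le]
  have t3 : 10574 / 10000 * √(15 / 2) / L ^ 2 * E ≤ 28960 / 10000 / L ^ 2 * E := by
    have : √(15 / 2) ≤ 27387 / 10000 := by
      rw [sqrt_le_left (by norm_num)]; norm_num
    gcongr
    linarith
  have t4 : 1372 / 1000 / (L * S) * exp (π * L / 30) ≤ 304 / 1000 / L ^ 2 * E := by
    rw [← hEa, div_mul_eq_mul_div (_ / _), div_mul_eq_mul_div (_ / _) (L ^ 2),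
      div_le_div_iff₀ (by positivity)
      (by positivity)]
    have h1 : 1372 / 1000 * L ≤ 304 / 1000 * a * S := by
      rw [← hSS]
      nlinarith [mul_le_mul_of_nonneg_left ha hS0.le]
    have h2 : 0 < exp (π * L / 30) * L := by positivity
    nlinarith [mul_le_mul_of_nonneg_left h1 h2.le]
  have t5 : 333 / 100 / L ^ 2 < √12 / (L ^ 2 + 1) := by
    have : 346 / 100 < √12 := by
      rw [lt_sqrt (by norm_num)]; norm_num
    rw [div_lt_div_iff₀ (by positivity) (by positivity)]
    nlinarith
  rw [hE2]
  calc _ ≤ 11 / 10000 / L ^ 2 * E ^ 2 + 101 / 100 * E * (872 / 10000 / L ^ 2 * E +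
        28960 / 10000 / L ^ 2 * E + 304 / 1000 / L ^ 2 * E) := by gcongr
    _ = (830293 / 250000) * (E ^ 2 / L ^ 2) := by ring
    _ ≤ 333 / 100 * (E ^ 2 / L ^ 2) :=
        mul_le_mul_of_nonneg_right (by norm_num) (by positivity)
    _ = 333 / 100 / L ^ 2 * E ^ 2 := by ring
    _ < _ := by gcongr

/-- The leading term of Rademacher's series for the number of partitions. -/
noncomputable def mainTerm (n : ℕ) : ℝ :=
  √12 / (24 * n - 1) * (1 - 6 / (π * √(24 * n - 1))) * exp (π * √(24 * n - 1) / 6)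

lemma abs_p_sub_mainTerm_lt_of_large {n : ℕ} (hn : 1000 ≤ n) :
    |p n - mainTerm n| < √12 / (24 * n) * exp (π * √(24 * n - 1) / 12) := by
  have hn' : (1000 : ℝ) ≤ n := by exact_mod_cast hn
  have h1 : √(24 * (n : ℝ) - 1) ^ 2 = 24 * n - 1 := sq_sqrt (by linarith)
  have h2 : 154 ≤ √(24 * (n : ℝ) - 1) := by
    rw [le_sqrt (by norm_num) (by linarith)]
    linarith
  have h3 := (abs_p_sub_main_le n h1 h2).trans_lt (circle_method_error_lt h2)
  rw [h1, sub_add_cancel] at h3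
  exact h3

section Recurrence

open PowerSeries
open scoped PowerSeries.WithPiTopology

lemma mk_card_partition_mul_pentagonalSeries :
    (PowerSeries.mk fun n ↦ (Fintype.card (Nat.Partition n) : ℤ)) * pentagonalSeries ℤ = 1 := by
  let : TopologicalSpace ℤ := ⊥
  have : DiscreteTopology ℤ := ⟨rfl⟩
  have h1 := Nat.Partition.hasProd_powerSeriesMk_card_restricted ℤ (fun _ ↦ True)
  have h2 := PowerSeries.WithPiTopology.hasProd_one_sub_X_pow ℤ
  have h3 := h1.mul h2
  have h4 : ∀ i : ℕ, (if True then ∑' j : ℕ, (X : ℤ⟦X⟧) ^ ((i + 1) * j) else 1) *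
      (1 - X ^ (i + 1)) = 1 := fun i ↦ by
    rw [if_pos trivial]
    have := PowerSeries.WithPiTopology.tsum_pow_mul_one_sub_of_constantCoeff_eq_zero
      (f := (X : ℤ⟦X⟧) ^ (i + 1)) (by simp)
    simpa [pow_mul] using this
  simp only [h4] at h3
  have h5 := h3.unique hasProd_one
  have h6 : ∀ n, Nat.Partition.restricted n (fun _ ↦ True) = Finset.univ := fun n ↦ by
    simp [Nat.Partition.restricted]
  simpa [h6] using h5

lemma coeff_pentagonalSeries_eq_sum (j K : ℕ) (h : 2 * j < K * (3 * K + 1)) :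
    (pentagonalSeries ℤ).coeff j = ∑ k ∈ Finset.range K, (-1) ^ k *
      ((if j = k * (3 * k + 1) / 2 then 1 else 0) -
        if j = (k + 1) * (3 * k + 2) / 2 then 1 else 0) := by
  let : TopologicalSpace ℤ := ⊥
  have : DiscreteTopology ℤ := ⟨rfl⟩
  have h1 := PowerSeries.WithPiTopology.hasSum_pow_pentagonal_sub_pentagonalSeries ℤ
  have h2 := h1.map (PowerSeries.coeff (R := ℤ) j)
    (PowerSeries.WithPiTopology.continuous_coeff ℤ j)
  have ha' : ∀ k : ℕ, 2 * pentagonal (-k) = k * (3 * k + 1) := fun k ↦ by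
    exact_mod_cast two_mul_natCast_pentagonal_neg k
  have hb' : ∀ k : ℕ, 2 * pentagonal (k + 1) = (k + 1) * (3 * k + 2) := fun k ↦ by
    zify
    rw [two_mul_natCast_pentagonal]
    ring
  have ha : ∀ k : ℕ, pentagonal (-k) = k * (3 * k + 1) / 2 := fun k ↦ by
    have := ha' k
    omega
  have hb : ∀ k : ℕ, pentagonal (k + 1) = (k + 1) * (3 * k + 2) / 2 := fun k ↦ by
    have := hb' k
    omega
  have h3 : ∀ k : ℕ, (PowerSeries.coeff (R := ℤ) j)
      ((-1) ^ k * (X ^ pentagonal (-k) - X ^ pentagonal (k + 1))) = (-1) ^ k *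
      ((if j = k * (3 * k + 1) / 2 then 1 else 0) -
        if j = (k + 1) * (3 * k + 2) / 2 then 1 else 0) := fun k ↦ by
    have : ((-1 : ℤ⟦X⟧) ^ k) = C ((-1 : ℤ) ^ k) := by simp
    rw [this, coeff_C_mul, map_sub, coeff_X_pow, coeff_X_pow, ha, hb]
  refine h2.unique ?_
  have h4 : HasSum (fun k : ℕ ↦ (-1 : ℤ) ^ k *
      ((if j = k * (3 * k + 1) / 2 then 1 else 0) -
        if j = (k + 1) * (3 * k + 2) / 2 then 1 else 0)) _ :=
    hasSum_sum_of_ne_finset_zero (s := Finset.range K) fun k hk ↦ by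
      have hk' : K ≤ k := by simpa using hk
      have e0 : K * (3 * K + 1) ≤ k * (3 * k + 1) := by gcongr
      have e1 : j < k * (3 * k + 1) / 2 := by
        have : 2 ∣ k * (3 * k + 1) := ⟨_, (ha' k).symm⟩
        omega
      have e2 : j < (k + 1) * (3 * k + 2) / 2 := by
        have : 2 ∣ (k + 1) * (3 * k + 2) := ⟨_, (hb' k).symm⟩
        have : k * (3 * k + 1) ≤ (k + 1) * (3 * k + 2) := by gcongr <;> omega
        omega
      rw [if_neg e1.ne, if_neg e2.ne]
      simp
  exact h4.congr_fun h3

lemma sum_range_two_mul_add_one {M : Type*} [AddCommMonoid M] (f : ℕ → M) (I : ℕ) :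
    ∑ k ∈ Finset.range (2 * I + 1), f k =
      f 0 + ∑ i ∈ Finset.range I, (f (2 * i + 1) + f (2 * i + 2)) := by
  induction I with
  | zero => simp
  | succ I ih =>
    rw [show 2 * (I + 1) + 1 = 2 * I + 1 + 1 + 1 by ring, Finset.sum_range_succ,
      Finset.sum_range_succ, ih, Finset.sum_range_succ (fun i ↦ f (2 * i + 1) + _)]
    simp only [add_assoc]

/-- The number of partitions of `n - m`, read as `0` when `n < m`. -/
def partitionCountSub (n m : ℕ) : ℕ := if m ≤ n then Fintype.card (Nat.Partition (n - m)) else 0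

lemma sum_antidiagonal_partition (n a : ℕ) :
    ∑ x ∈ Finset.HasAntidiagonal.antidiagonal n,
      (Fintype.card (Nat.Partition x.1) : ℤ) * (if x.2 = a then 1 else 0) =
      partitionCountSub n a := by
  simp only [mul_ite, mul_one, mul_zero, partitionCountSub]
  split_ifs with h
  · rw [Finset.sum_eq_single (n - a, a)]
    · simp
    · rintro ⟨x, y⟩ hx hne
      rw [Finset.HasAntidiagonal.mem_antidiagonal] at hx
      rw [if_neg]
      rintro rfl
      apply hne
      simp only at hx ⊢
      ext <;> simp
      omega
    · intro h'
      exact absurd (Finset.HasAntidiagonal.mem_antidiagonal.2 (by simp; omega)) h'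
  · rw [Nat.cast_zero]
    refine Finset.sum_eq_zero fun x hx ↦ if_neg ?_
    rw [Finset.HasAntidiagonal.mem_antidiagonal] at hx
    omega

/-- Euler's pentagonal recurrence for the number of partitions. -/
lemma card_partition_add_sum (n I : ℕ) (hn : n ≠ 0) (h : 2 * n < (2 * I + 1) * (6 * I + 4)) :
    Fintype.card (Nat.Partition n) + ∑ i ∈ Finset.range I,
      (partitionCountSub n ((i + 1) * (6 * i + 5)) +
        partitionCountSub n ((i + 1) * (6 * i + 7))) =
    partitionCountSub n 1 + ∑ i ∈ Finset.range I,
      (partitionCountSub n ((2 * i + 1) * (3 * i + 2)) +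
        partitionCountSub n ((2 * i + 3) * (3 * i + 4))) := by
  have h1 := congrArg (PowerSeries.coeff n) mk_card_partition_mul_pentagonalSeries
  rw [PowerSeries.coeff_mul, PowerSeries.coeff_one, if_neg hn] at h1
  have h2 : ∀ x ∈ Finset.HasAntidiagonal.antidiagonal n,
      (coeff x.1) (PowerSeries.mk fun n ↦ (Fintype.card (Nat.Partition n) : ℤ)) *
        (coeff x.2) (pentagonalSeries ℤ) = ∑ k ∈ Finset.range (2 * I + 1), (-1) ^ k *
      ((Fintype.card (Nat.Partition x.1) : ℤ) * (if x.2 = k * (3 * k + 1) / 2 then 1 else 0) -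
        (Fintype.card (Nat.Partition x.1) : ℤ) *
          (if x.2 = (k + 1) * (3 * k + 2) / 2 then 1 else 0)) := fun x hx ↦ by
    rw [Finset.HasAntidiagonal.mem_antidiagonal] at hx
    rw [coeff_pentagonalSeries_eq_sum x.2 (2 * I + 1) (by nlinarith only [hx, h]), coeff_mk,
      Finset.mul_sum]
    exact Finset.sum_congr rfl fun k _ ↦ by ring
  rw [Finset.sum_congr rfl h2, Finset.sum_comm] at h1
  simp only [← Finset.mul_sum, Finset.sum_sub_distrib, sum_antidiagonal_partition] at h1
  rw [sum_range_two_mul_add_one] at h1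
  have e1 : ∀ i, (2 * i + 1) * (3 * (2 * i + 1) + 1) / 2 = (2 * i + 1) * (3 * i + 2) := fun i ↦
    Nat.div_eq_of_eq_mul_left two_pos (by ring)
  have e2 : ∀ i, (2 * i + 1 + 1) * (3 * (2 * i + 1) + 2) / 2 = (i + 1) * (6 * i + 5) := fun i ↦
    Nat.div_eq_of_eq_mul_left two_pos (by ring)
  have e3 : ∀ i, (2 * i + 2) * (3 * (2 * i + 2) + 1) / 2 = (i + 1) * (6 * i + 7) := fun i ↦
    Nat.div_eq_of_eq_mul_left two_pos (by ring)
  have e4 : ∀ i, (2 * i + 2 + 1) * (3 * (2 * i + 2) + 2) / 2 = (2 * i + 3) * (3 * i + 4) :=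
    fun i ↦ Nat.div_eq_of_eq_mul_left two_pos (by ring)
  have e5 : ∀ i, (-1 : ℤ) ^ (2 * i + 1) = -1 := fun i ↦ by rw [pow_succ, pow_mul]; simp
  have e6 : ∀ i, (-1 : ℤ) ^ (2 * i + 2) = 1 := fun i ↦ by
    rw [show 2 * i + 2 = 2 * (i + 1) by ring, pow_mul]; simp
  have e7 : partitionCountSub n 0 = Fintype.card (Nat.Partition n) := by
    simp [partitionCountSub]
  simp only [e1, e2, e3, e4, e5, e6] at h1
  norm_num at h1
  rw [e7] at h1
  zify
  simp only [Finset.sum_add_distrib, Finset.sum_sub_distrib] at h1 ⊢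
  linarith only [h1]

end Recurrence

section SmallCases

/-- `force n f` is `f n`, written so that the kernel evaluates `n` before passing it on. -/
def force (n : ℕ) (f : ℕ → Bool) : Bool := Nat.rec (f 0) (fun m _ ↦ f (Nat.succ m)) n

lemma force_eq (n : ℕ) (f : ℕ → Bool) : force n f = f n := by cases n <;> rfl

/-- Numerator of the Taylor polynomial of degree `d` of `exp` at `a / b`, over `b ^ d * d !`. -/
def expNum (a b : ℕ) : ℕ → ℕ
  | 0 => 1
  | d + 1 => expNum a b d * b * (d + 1) + a ^ (d + 1)

/-- Apply `f` to the result of `d` Newton steps for the square root of `A`, started at `r`. -/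
def withSqrt (A : ℕ) : ℕ → ℕ → (ℕ → Bool) → Bool
  | 0, r, f => f r
  | d + 1, r, f => force ((r + A / r) / 2) fun s ↦ withSqrt A d s f

lemma exists_of_withSqrt {A d r : ℕ} {f : ℕ → Bool} (h : withSqrt A d r f = true) :
    ∃ s, f s = true := by
  induction d generalizing r with
  | zero => exact ⟨r, h⟩
  | succ d ih =>
    rw [withSqrt, force_eq] at h
    exact ih h

/-- The comparison of `v` with the main term at `n`, given `a / b ≤ x / 64 ≤ a' / b`,
`f / e ≤ exp (x / 64) ≤ f' / e` and `s / t ≤ √3 ≤ (s + 1) / t`, where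
`x = π * √(24 * n - 1) / 12`. -/
def checkBounds (b e s t n v a a' f f' : ℕ) : Bool :=
  Nat.ble b (128 * a) &&
  Nat.blt (v * (24 * n - 1) * (s + 1) * (128 * a * (24 * n)) * e ^ 128)
    (6 * t * ((128 * a - b) * (24 * n) * f ^ 128 +
      (24 * n - 1) * (128 * a) * f ^ 64 * e ^ 64)) &&
  Nat.blt (6 * t * ((128 * a' - b) * (24 * n) * f' ^ 128))
    (v * (24 * n - 1) * s * (128 * a' * (24 * n)) * e ^ 128 +
      6 * t * ((24 * n - 1) * (128 * a') * f ^ 64 * e ^ 64))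

/-- A certified comparison of `v` with the main term at `n`. -/
def checkMainTerm (n v : ℕ) : Bool :=
  withSqrt ((24 * n - 1) * 4 ^ 75) 15 (2 ^ 83) fun r ↦
    Nat.ble (r ^ 2) ((24 * n - 1) * 4 ^ 75) && Nat.blt ((24 * n - 1) * 4 ^ 75) ((r + 1) ^ 2) &&
    force (314159265358979323846 * r / (768 * 10 ^ 20 * 8)) fun a ↦
    force (314159265358979323847 * (r + 1) / (768 * 10 ^ 20 * 8) + 1) fun a' ↦
    force (expNum a (2 ^ 72) 21 * 2 ^ 80 / ((2 ^ 72) ^ 21 * 51090942171709440000)) fun f ↦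
    force ((expNum a' (2 ^ 72) 21 + a' ^ 21) * 2 ^ 80 /
      ((2 ^ 72) ^ 21 * 51090942171709440000) + 1) fun f' ↦
    Nat.ble a' (2 ^ 72) &&
      checkBounds (2 ^ 72) (2 ^ 80) 2195635245840476761639769790215 (2 ^ 100)
        n v a a' f f'

/-- The terms of positive sign in the pentagonal recurrence. -/
def pentagonalPos (q : ℕ → ℕ) : ℕ → ℕ
  | 0 => q 1
  | i + 1 => pentagonalPos q i + (q ((2 * i + 1) * (3 * i + 2)) + q ((2 * i + 3) * (3 * i + 4)))

/-- The terms of negative sign in the pentagonal recurrence. -/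
def pentagonalNeg (q : ℕ → ℕ) : ℕ → ℕ
  | 0 => 0
  | i + 1 => pentagonalNeg q i + (q ((i + 1) * (6 * i + 5)) + q ((i + 1) * (6 * i + 7)))

/-- Run `checkMainTerm` on the number of partitions of `n, n + 1, …`, where the base `2 ^ 128`
digits of `T` are the numbers of partitions of `n - 1, n - 2, …, 0`. -/
def runCheck : ℕ → ℕ → ℕ → Bool
  | 0, _, _ => true
  | d + 1, n, T =>
    force (pentagonalPos (fun m ↦ T / (2 ^ 128) ^ (m - 1) % 2 ^ 128) 13 -
      pentagonalNeg (fun m ↦ T / (2 ^ 128) ^ (m - 1) % 2 ^ 128) 13) fun v ↦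
    Nat.blt v (2 ^ 128) && checkMainTerm n v && force n.succ fun n' ↦
    force (T * 2 ^ 128 + v) fun T' ↦ runCheck d n' T'

set_option maxRecDepth 100000 in
lemma runCheck_eq_true : runCheck 999 1 1 = true := by decide +kernel

lemma expNum_div (a b d : ℕ) (hb : b ≠ 0) :
    (expNum a b d : ℝ) / ((b : ℝ) ^ d * d.factorial) =
      ∑ i ∈ Finset.range (d + 1), ((a : ℝ) / b) ^ i / i.factorial := by
  have hb' : (b : ℝ) ≠ 0 := by exact_mod_cast hb
  induction d with
  | zero => simp [expNum]
  | succ d ih =>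
    have hd : (d.factorial : ℝ) ≠ 0 := by positivity
    have hd' : (d : ℝ) + 1 ≠ 0 := by positivity
    rw [Finset.sum_range_succ, ← ih, expNum, Nat.factorial_succ]
    push_cast
    rw [div_pow]
    field_simp
    ring

lemma expNum_le_exp (a b d : ℕ) (hb : b ≠ 0) :
    (expNum a b d : ℝ) / ((b : ℝ) ^ d * d.factorial) ≤ exp (a / b) := by
  rw [expNum_div a b d hb]
  exact sum_le_exp_of_nonneg (by positivity) _

lemma exp_le_expNum (a b d : ℕ) (hb : b ≠ 0) (hab : a ≤ b) (hd : 2 ≤ d) :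
    exp (a / b) ≤ ((expNum a b d : ℝ) + a ^ d) / ((b : ℝ) ^ d * d.factorial) := by
  have hb' : (0 : ℝ) < b := by exact_mod_cast Nat.pos_of_ne_zero hb
  have hx : (a : ℝ) / b ≤ 1 := by rw [div_le_one hb']; exact_mod_cast hab
  have hx0 : 0 ≤ (a : ℝ) / b := by positivity
  rw [add_div, expNum_div a b d hb, ← div_div, ← div_pow]
  refine (exp_bound' hx0 hx d.succ_pos).trans (add_le_add_right ?_ _)
  have hd' : (2 : ℝ) ≤ d := by exact_mod_cast hd
  rw [Nat.succ_eq_add_one, Nat.factorial_succ]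
  push_cast
  rw [div_le_div_iff₀ (by positivity) (by positivity), pow_succ]
  have : (a : ℝ) / b * ((d : ℝ) + 1 + 1) ≤ ((d : ℝ) + 1) * (d + 1) := by nlinarith
  calc _ = ((a : ℝ) / b) ^ d * d.factorial * ((a : ℝ) / b * ((d : ℝ) + 1 + 1)) := by ring
    _ ≤ ((a : ℝ) / b) ^ d * d.factorial * (((d : ℝ) + 1) * (d + 1)) := by gcongr
    _ = _ := by ring

lemma natCast_div_mul_le (m k c : ℕ) (hc : 0 < c) :
    ((m * c / k : ℕ) : ℝ) / c ≤ m / k := by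
  have hc' : (0 : ℝ) < c := by exact_mod_cast hc
  rw [div_le_iff₀ hc', div_mul_eq_mul_div]
  exact_mod_cast (Nat.cast_div_le (m := m * c) (n := k) (α := ℝ))

lemma le_natCast_div_mul (m k c : ℕ) (hk : 0 < k) (hc : 0 < c) :
    (m : ℝ) / k ≤ ((m * c / k + 1 : ℕ) : ℝ) / c := by
  have hc' : (0 : ℝ) < c := by exact_mod_cast hc
  have hk' : (0 : ℝ) < k := by exact_mod_cast hk
  rw [le_div_iff₀ hc', div_mul_eq_mul_div, div_le_iff₀ hk']
  have := Nat.lt_mul_div_succ (m * c) hk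
  have : m * c ≤ (m * c / k + 1) * k := by rw [mul_comm _ k]; exact this.le
  exact_mod_cast this

lemma abs_sub_mainTerm_lt_of_checkBounds {b e s t n v a a' f f' : ℕ} {x : ℝ} (hn : 1 ≤ n)
    (hb : 0 < b) (he : 0 < e) (ht : 0 < t)
    (hs1 : (s : ℝ) / t ≤ √3) (hs2 : √3 ≤ ((s : ℝ) + 1) / t)
    (hx : x = π * √(24 * n - 1) / 12)
    (ha : (a : ℝ) / b ≤ x / 64) (ha' : x / 64 ≤ (a' : ℝ) / b)
    (hf : (f : ℝ) / e ≤ exp (x / 64)) (hf' : exp (x / 64) ≤ (f' : ℝ) / e)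
    (h : checkBounds b e s t n v a a' f f' = true) :
    |(v : ℝ) - mainTerm n| < √12 / (24 * n) * exp x := by
  simp only [checkBounds, Bool.and_eq_true, Nat.ble_eq, Nat.blt_eq] at h
  obtain ⟨⟨h1, h2⟩, h3⟩ := h
  have hn' : (1 : ℝ) ≤ n := by exact_mod_cast hn
  have hb' : (0 : ℝ) < b := by exact_mod_cast hb
  have he' : (0 : ℝ) < e := by exact_mod_cast he
  have ht' : (0 : ℝ) < t := by exact_mod_cast ht
  set L := √(24 * (n : ℝ) - 1) with hL
  have hQ : (0 : ℝ) < 24 * n - 1 := by linarith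
  have hL0 : 0 < L := sqrt_pos.2 hQ
  have hx0 : 0 < x := by rw [hx]; positivity
  have haa : (a : ℝ) ≤ a' := by
    have := ha.trans ha'
    rwa [div_le_div_iff_of_pos_right (by positivity)] at this
  have h1' : (b : ℝ) ≤ 128 * a := by exact_mod_cast h1
  have h1'' : (b : ℝ) ≤ 128 * a' := by linarith
  have ha0 : (0 : ℝ) < a := by linarith
  have ha0' : (0 : ℝ) < a' := by linarith
  have hc1 : ((24 * n - 1 : ℕ) : ℝ) = 24 * n - 1 := by
    rw [Nat.cast_sub (by omega)]; push_cast; rfl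
  have hc2 : ((128 * a - b : ℕ) : ℝ) = 128 * a - b := by
    rw [Nat.cast_sub h1]; push_cast; rfl
  have hc3 : ((128 * a' - b : ℕ) : ℝ) = 128 * a' - b := by
    rw [Nat.cast_sub (by exact_mod_cast h1'')]; push_cast; rfl
  have hT64 : exp (x / 64) ^ 64 = exp x := by
    rw [← exp_nat_mul]; congr 1; push_cast; ring
  have hf1 : (f : ℝ) ^ 64 / e ^ 64 ≤ exp x := by
    rw [← hT64, ← div_pow]
    gcongr
  have hf2 : exp x ≤ (f' : ℝ) ^ 64 / e ^ 64 := by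
    rw [← hT64, ← div_pow]
    gcongr
  have hT0 := exp_pos x
  have h2' := (Nat.cast_lt (α := ℝ)).2 h2
  have h3' := (Nat.cast_lt (α := ℝ)).2 h3
  push_cast [hc1, hc2, hc3] at h2' h3'
  rw [pow_mul (f : ℝ) 64 2, pow_mul (e : ℝ) 64 2] at h2'
  rw [pow_mul (f' : ℝ) 64 2, pow_mul (e : ℝ) 64 2] at h3'
  have hE0 : 0 < (e : ℝ) ^ 64 := by positivity
  have hF0 : 0 ≤ (f : ℝ) ^ 64 := pow_nonneg f.cast_nonneg _
  have hF0' : 0 ≤ (f' : ℝ) ^ 64 := pow_nonneg f'.cast_nonneg _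
  generalize (e : ℝ) ^ 64 = E at *
  generalize (f : ℝ) ^ 64 = F at *
  generalize (f' : ℝ) ^ 64 = F' at *
  set Q : ℝ := 24 * n - 1 with hQdef
  have u2 : v * Q * (((s : ℝ) + 1) / t) / 6 <
      (1 - b / (128 * a)) * (F / E) ^ 2 + Q / (24 * n) * (F / E) := by
    have e1 : v * Q * (((s : ℝ) + 1) / t) / 6 = (v * Q * (s + 1) * (128 * a * (24 * n)) * E ^ 2) /
        (6 * t * (128 * a * (24 * n)) * E ^ 2) := by field_simp
    have e2 : (1 - b / (128 * a)) * (F / E) ^ 2 + Q / (24 * n) * (F / E) =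
        (6 * t * ((128 * a - b) * (24 * n) * F ^ 2 + Q * (128 * a) * F * E)) /
        (6 * t * (128 * a * (24 * n)) * E ^ 2) := by field_simp
    rw [e1, e2]
    gcongr
  have u3 : (1 - b / (128 * a')) * (F' / E) ^ 2 <
      v * Q * ((s : ℝ) / t) / 6 + Q / (24 * n) * (F / E) := by
    have e1 : v * Q * ((s : ℝ) / t) / 6 + Q / (24 * n) * (F / E) =
        (v * Q * s * (128 * a' * (24 * n)) * E ^ 2 + 6 * t * (Q * (128 * a') * F * E)) /
        (6 * t * (128 * a' * (24 * n)) * E ^ 2) := by field_simp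
    have e2 : (1 - b / (128 * a')) * (F' / E) ^ 2 =
        (6 * t * ((128 * a' - b) * (24 * n) * F' ^ 2)) /
        (6 * t * (128 * a' * (24 * n)) * E ^ 2) := by field_simp
    rw [e1, e2]
    gcongr
  have hμ1 : 1 / (2 * x) ≤ (b : ℝ) / (128 * a) := by
    rw [div_le_div_iff₀ hb' (by positivity)] at ha
    rw [div_le_div_iff₀ (by positivity) (by positivity)]
    linarith
  have hμ2 : (b : ℝ) / (128 * a') ≤ 1 / (2 * x) := by
    rw [div_le_div_iff₀ (by positivity) hb'] at ha'
    rw [div_le_div_iff₀ (by positivity) (by positivity)]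
    linarith
  have hμ3 : (b : ℝ) / (128 * a) ≤ 1 := by rwa [div_le_one (by positivity)]
  have hθ : 0 < Q / (24 * n) := by positivity
  have w2 : v * Q * √3 / 6 < (1 - 1 / (2 * x)) * exp x ^ 2 + Q / (24 * n) * exp x := by
    calc _ ≤ v * Q * (((s : ℝ) + 1) / t) / 6 := by gcongr
      _ < _ := u2
      _ ≤ _ := by gcongr; linarith
  have w3 : (1 - 1 / (2 * x)) * exp x ^ 2 < v * Q * √3 / 6 + Q / (24 * n) * exp x := by
    calc _ ≤ (1 - b / (128 * a')) * (F' / E) ^ 2 := by gcongr; linarith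
      _ < _ := u3
      _ ≤ _ := by gcongr
  have hm : mainTerm n = √12 / Q * ((1 - 1 / (2 * x)) * exp x ^ 2) := by
    have e1 : 6 / (π * L) = 1 / (2 * x) := by rw [hx]; field_simp; norm_num
    have e2 : exp x ^ 2 = exp (π * L / 6) := by
      rw [← exp_nat_mul, hx]; congr 1; push_cast; ring
    rw [mainTerm, e2, ← e1]
    ring
  have h12 : √12 = 2 * √3 := by
    rw [show (12 : ℝ) = 2 ^ 2 * 3 by norm_num, sqrt_mul (by norm_num), sqrt_sq (by norm_num)]
  have h3 : √3 * √3 = 3 := mul_self_sqrt (by norm_num)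
  have hv : (v : ℝ) = √12 / Q * (v * Q * √3 / 6) := by
    rw [h12]; field_simp; linear_combination (-2 * v : ℝ) * h3
  have hr : √12 / (24 * n) * exp x = √12 / Q * (Q / (24 * n) * exp x) := by
    field_simp
  have hpos : 0 < √12 / Q := by positivity
  rw [hm, hr, hv, ← mul_sub, abs_mul, abs_of_pos hpos]
  refine mul_lt_mul_of_pos_left ?_ hpos
  rw [abs_lt]
  constructor <;> linarith

lemma abs_sub_mainTerm_lt_of_checkMainTerm {n v : ℕ} (hn : 1 ≤ n)
    (h : checkMainTerm n v = true) :
    |(v : ℝ) - mainTerm n| < √12 / (24 * n) * exp (π * √(24 * n - 1) / 12) := by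
  obtain ⟨r, h⟩ := exists_of_withSqrt h
  simp only [force_eq, Bool.and_eq_true, Nat.ble_eq, Nat.blt_eq] at h
  obtain ⟨⟨h1, h2⟩, h3, h4⟩ := h
  have hn' : (1 : ℝ) ≤ n := by exact_mod_cast hn
  have hc1 : ((24 * n - 1 : ℕ) : ℝ) = 24 * n - 1 := by
    rw [Nat.cast_sub (by omega)]; push_cast; rfl
  have hQ : (0 : ℝ) < 24 * n - 1 := by linarith
  set L := √(24 * (n : ℝ) - 1) with hL
  have hL0 : 0 < L := sqrt_pos.2 hQ
  have hLL : ((24 * n - 1 : ℕ) : ℝ) * 4 ^ 75 = (L * 2 ^ 75) ^ 2 := by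
    rw [hc1, mul_pow, sq_sqrt hQ.le, ← pow_mul, mul_comm 75 2, pow_mul]
    norm_num
  have hr1 : (r : ℝ) ≤ L * 2 ^ 75 := by
    rw [← abs_of_nonneg (by positivity : (0 : ℝ) ≤ r),
      ← abs_of_pos (by positivity : 0 < L * 2 ^ 75),
      ← sq_le_sq, ← hLL]
    exact_mod_cast h1
  have hr2 : L * 2 ^ 75 ≤ (r : ℝ) + 1 := by
    rw [← abs_of_nonneg (by positivity : (0 : ℝ) ≤ r + 1),
      ← abs_of_pos (by positivity : 0 < L * 2 ^ 75), ← sq_le_sq, ← hLL]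
    exact_mod_cast h2.le
  have hπ1 : 314159265358979323846 / 10 ^ 20 ≤ π := by
    have := pi_gt_d20
    norm_num at this ⊢
    linarith
  have hπ2 : π ≤ 314159265358979323847 / 10 ^ 20 := by
    have := pi_lt_d20
    norm_num at this ⊢
    linarith
  have ha : ((314159265358979323846 * r / (768 * 10 ^ 20 * 8) : ℕ) : ℝ) / (2 ^ 72 : ℕ) ≤
      π * L / 12 / 64 := by
    rw [div_le_iff₀ (by positivity)]
    refine Nat.cast_div_le.trans ?_
    push_cast
    calc (314159265358979323846 * r / 614400000000000000000000 : ℝ) =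
        (314159265358979323846 / 10 ^ 20) * r / 6144 := by ring
      _ ≤ π * (L * 2 ^ 75) / 6144 := by gcongr
      _ = _ := by ring
  have ha' : π * L / 12 / 64 ≤
      ((314159265358979323847 * (r + 1) / (768 * 10 ^ 20 * 8) + 1 : ℕ) : ℝ) / (2 ^ 72 : ℕ) := by
    rw [le_div_iff₀ (by positivity)]
    have := (Nat.lt_floor_add_one ((314159265358979323847 * (r + 1) : ℕ) /
      (768 * 10 ^ 20 * 8 : ℕ) : ℝ)).le
    rw [Nat.floor_div_eq_div] at this
    rw [Nat.cast_add_one]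
    refine le_trans ?_ this
    push_cast
    calc π * L / 12 / 64 * 4722366482869645213696 = π * (L * 2 ^ 75) / 6144 := by ring
      _ ≤ (314159265358979323847 / 10 ^ 20) * (r + 1) / 6144 := by gcongr
      _ = _ := by ring
  have hfac : 51090942171709440000 = Nat.factorial 21 := rfl
  generalize 314159265358979323846 * r / (768 * 10 ^ 20 * 8) = a at *
  generalize 314159265358979323847 * (r + 1) / (768 * 10 ^ 20 * 8) + 1 = a' at *
  rw [hfac] at h4
  generalize hb : 2 ^ 72 = b at *
  have hb0 : 0 < b := by rw [← hb]; positivity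
  generalize he : 2 ^ 80 = e at *
  have he0 : 0 < e := by rw [← he]; positivity
  have hk : 0 < b ^ 21 * Nat.factorial 21 := by positivity
  refine abs_sub_mainTerm_lt_of_checkBounds hn hb0 he0 (by positivity) ?_ ?_ rfl ha ha'
    ((natCast_div_mul_le _ _ _ he0).trans ?_) (le_trans ?_ (le_natCast_div_mul _ _ _ hk he0)) h4
  · apply le_sqrt_of_sq_le
    norm_num
  · apply sqrt_le_iff.2 ⟨by positivity, ?_⟩
    norm_num
  · push_cast
    exact (expNum_le_exp a b 21 hb0.ne').trans (exp_le_exp.2 ha)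
  · push_cast
    exact (exp_le_exp.2 ha').trans (exp_le_expNum a' b 21 hb0.ne' h3 (by norm_num))

lemma pentagonalPos_eq (q : ℕ → ℕ) (I : ℕ) : pentagonalPos q I = q 1 +
    ∑ i ∈ Finset.range I, (q ((2 * i + 1) * (3 * i + 2)) + q ((2 * i + 3) * (3 * i + 4))) := by
  induction I with
  | zero => simp [pentagonalPos]
  | succ I ih => rw [pentagonalPos, ih, Finset.sum_range_succ, add_assoc]

lemma pentagonalNeg_eq (q : ℕ → ℕ) (I : ℕ) : pentagonalNeg q I =
    ∑ i ∈ Finset.range I, (q ((i + 1) * (6 * i + 5)) + q ((i + 1) * (6 * i + 7))) := by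
  induction I with
  | zero => simp [pentagonalNeg]
  | succ I ih => rw [pentagonalNeg, ih, Finset.sum_range_succ]

lemma pentagonalPos_sub_pentagonalNeg {n I : ℕ} {q : ℕ → ℕ} (hn : n ≠ 0)
    (h : 2 * n < (2 * I + 1) * (6 * I + 4)) (hq : ∀ m, 1 ≤ m → q m = partitionCountSub n m) :
    pentagonalPos q I - pentagonalNeg q I = Fintype.card (Nat.Partition n) := by
  have e1 : ∀ i, q ((2 * i + 1) * (3 * i + 2)) + q ((2 * i + 3) * (3 * i + 4)) =
      partitionCountSub n ((2 * i + 1) * (3 * i + 2)) +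
        partitionCountSub n ((2 * i + 3) * (3 * i + 4)) := fun i ↦ by
    rw [hq _ (by nlinarith), hq _ (by nlinarith)]
  have e2 : ∀ i, q ((i + 1) * (6 * i + 5)) + q ((i + 1) * (6 * i + 7)) =
      partitionCountSub n ((i + 1) * (6 * i + 5)) +
        partitionCountSub n ((i + 1) * (6 * i + 7)) := fun i ↦ by
    rw [hq _ (by nlinarith), hq _ (by nlinarith)]
  rw [pentagonalPos_eq, pentagonalNeg_eq, hq 1 le_rfl]
  simp only [e1, e2]
  rw [← card_partition_add_sum n I hn h, Nat.add_sub_cancel]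

lemma checkMainTerm_of_runCheck {d n T : ℕ} (hn : n ≠ 0) (hd : n + d ≤ 1000)
    (hT : ∀ m, 1 ≤ m → T / (2 ^ 128) ^ (m - 1) % 2 ^ 128 = partitionCountSub n m)
    (h : runCheck d n T = true) {k : ℕ} (hk : n ≤ k) (hk' : k < n + d) :
    checkMainTerm k (Fintype.card (Nat.Partition k)) = true := by
  induction d generalizing n T with
  | zero => omega
  | succ d ih =>
    rw [runCheck, pentagonalPos_sub_pentagonalNeg hn (by omega) hT] at h
    simp only [force_eq, Bool.and_eq_true, Nat.blt_eq] at h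
    obtain ⟨⟨h1, h2⟩, h3⟩ := h
    rcases hk.eq_or_lt with rfl | hk
    · exact h2
    refine ih n.succ_ne_zero (by omega) (fun m hm ↦ ?_) h3 hk (by omega)
    obtain ⟨m, rfl⟩ := Nat.exists_eq_add_of_le' hm
    have hT' := hT m
    generalize 2 ^ 128 = W at *
    have hW : 0 < W := by omega
    rw [Nat.add_sub_cancel]
    rcases m with _ | m
    · rw [pow_zero, Nat.div_one, Nat.mul_add_mod_self_right, Nat.mod_eq_of_lt h1]
      simp [partitionCountSub]
    · rw [pow_succ', ← Nat.div_div_eq_div_mul, mul_comm T, Nat.mul_add_div hW,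
        Nat.div_eq_of_lt h1, add_zero]
      have := hT' (by omega)
      rw [Nat.add_sub_cancel] at this
      rw [this]
      simp [partitionCountSub]

/-- The number of partitions differs from its main term by less than the square root of the
latter, roughly. -/
lemma abs_p_sub_mainTerm_lt {n : ℕ} (hn : 1 ≤ n) :
    |p n - mainTerm n| < √12 / (24 * n) * exp (π * √(24 * n - 1) / 12) := by
  rcases le_or_gt 1000 n with h | h
  · exact abs_p_sub_mainTerm_lt_of_large h
  · refine abs_sub_mainTerm_lt_of_checkMainTerm hn
      (checkMainTerm_of_runCheck one_ne_zero le_rfl (fun m hm ↦ ?_) runCheck_eq_true hn (by omega))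
    obtain ⟨m, rfl⟩ := Nat.exists_eq_add_of_le' hm
    rw [Nat.add_sub_cancel]
    rcases m with _ | m
    · simp [partitionCountSub]
    · rw [Nat.div_eq_of_lt (Nat.one_lt_pow m.succ_ne_zero (by norm_num))]
      simp [partitionCountSub]

end SmallCases

section GeneratingFunction

lemma ring_choose_succ (a : ℝ) (n : ℕ) :
    Ring.choose a (n + 1) = Ring.choose a n * (a - n) / (n + 1) := by
  have hn : (n.factorial : ℝ) ≠ 0 := by positivity
  have hn' : (n : ℝ) + 1 ≠ 0 := by positivity
  rw [Ring.choose_eq_smul, Ring.choose_eq_smul, descPochhammer_succ_right, Polynomial.smeval_mul,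
    Polynomial.smeval_sub, Polynomial.smeval_X, Polynomial.smeval_natCast, Nat.factorial_succ]
  simp only [smul_eq_mul, pow_one, pow_zero, nsmul_eq_mul, mul_one]
  push_cast
  field_simp

lemma centralBinom_succ_real (n : ℕ) :
    ((n + 1).centralBinom : ℝ) = n.centralBinom * (2 * (2 * n + 1)) / (n + 1) := by
  have hn' : (n : ℝ) + 1 ≠ 0 := by positivity
  have := Nat.succ_mul_centralBinom_succ n
  rw [eq_div_iff hn']
  have : ((n : ℝ) + 1) * (n + 1).centralBinom = 2 * (2 * n + 1) * n.centralBinom := by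
    exact_mod_cast this
  linarith

lemma ring_choose_neg_half (n : ℕ) :
    Ring.choose (-1 / 2 : ℝ) n = (-1) ^ n * n.centralBinom / 4 ^ n := by
  induction n with
  | zero => simp
  | succ n ih =>
    have hn' : (n : ℝ) + 1 ≠ 0 := by positivity
    rw [ring_choose_succ, ih, centralBinom_succ_real]
    field_simp
    ring

lemma ring_choose_neg_three_half (n : ℕ) :
    Ring.choose (-3 / 2 : ℝ) n = (-1) ^ n * ((2 * n + 1) * n.centralBinom) / 4 ^ n := by
  induction n with
  | zero => simp
  | succ n ih =>
    have hn' : (n : ℝ) + 1 ≠ 0 := by positivity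
    rw [ring_choose_succ, ih, centralBinom_succ_real]
    push_cast
    field_simp
    ring

lemma hasSum_binomial (a : ℝ) {z : ℝ} (hz : |z| < 1) :
    HasSum (fun n ↦ Ring.choose a n * z ^ n) ((1 + z) ^ a) := by
  have := (one_add_rpow_hasFPowerSeriesOnBall_zero (a := a)).hasSum (y := z)
    (by simpa [enorm_eq_nnnorm, ← NNReal.coe_lt_coe] using hz)
  simpa [binomialSeries, FormalMultilinearSeries.ofScalars] using this

lemma _root_.HasSum.of_eq {f g : ℕ → ℝ} {a b : ℝ} (h : HasSum f a) (hfg : ∀ k, g k = f k)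
    (hab : b = a) : HasSum g b := by
  rwa [hab, funext hfg]

variable {y s : ℝ}

lemma hasSum_centralBinom (hs : 0 < s) (hy : s ^ 2 + 4 * y ^ 2 = 1) :
    HasSum (fun k ↦ (Nat.centralBinom k : ℝ) * y ^ (2 * k)) (1 / s) := by
  have hz : |-(4 * y ^ 2)| < 1 := by
    rw [abs_neg, abs_of_nonneg (by positivity)]
    nlinarith
  convert hasSum_binomial (-1 / 2) hz using 1
  · ext k
    rw [ring_choose_neg_half, neg_pow (4 * y ^ 2), mul_pow, ← pow_mul]
    have : (-1 : ℝ) ^ k * (-1) ^ k = 1 := by rw [← mul_pow]; simp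
    field_simp
    linear_combination (-(k.centralBinom : ℝ) * y ^ (2 * k)) * this
  · rw [show 1 + -(4 * y ^ 2) = s ^ 2 by linarith, ← rpow_natCast, ← rpow_mul hs.le]
    norm_num [rpow_neg_one]

lemma hasSum_two_mul_add_one_mul_centralBinom (hs : 0 < s) (hy : s ^ 2 + 4 * y ^ 2 = 1) :
    HasSum (fun k : ℕ ↦ (2 * (k : ℝ) + 1) * Nat.centralBinom k * y ^ (2 * k)) (1 / s ^ 3) := by
  have hz : |-(4 * y ^ 2)| < 1 := by
    rw [abs_neg, abs_of_nonneg (by positivity)]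
    nlinarith
  convert hasSum_binomial (-3 / 2) hz using 1
  · ext k
    rw [ring_choose_neg_three_half, neg_pow (4 * y ^ 2), mul_pow, ← pow_mul]
    have : (-1 : ℝ) ^ k * (-1) ^ k = 1 := by rw [← mul_pow]; simp
    field_simp
    linear_combination (-(k.centralBinom : ℝ) * y ^ (2 * k)) * this
  · rw [show 1 + -(4 * y ^ 2) = s ^ 2 by linarith, ← rpow_natCast s 2, ← rpow_mul hs.le]
    norm_num [rpow_neg hs.le]

lemma centralBinom_succ_eq_two_mul_choose (k : ℕ) :
    ((k + 1).centralBinom : ℝ) = 2 * ((1 + 2 * k).choose k : ℕ) := by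
  have h : (1 + 2 * k).choose (k + 1) = (1 + 2 * k).choose k :=
    Nat.choose_symm_of_eq_add (by ring)
  rw [Nat.centralBinom, show 2 * (k + 1) = (1 + 2 * k) + 1 by ring, Nat.choose_succ_succ, h]
  push_cast
  ring

lemma choose_add_two_mul_succ (l k : ℕ) :
    (((l + 1) + 2 * (k + 1)).choose (k + 1) : ℝ) =
      (l + 2 * (k + 1)).choose (k + 1) + ((l + 2) + 2 * k).choose k := by
  rw [show l + 1 + 2 * (k + 1) = (l + 2 + 2 * k) + 1 by ring, Nat.choose_succ_succ,
    show l + 2 * (k + 1) = l + 2 + 2 * k by ring]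
  push_cast
  ring

lemma hasSum_choose (hs : 0 < s) (hy0 : y ≠ 0) (hy : s ^ 2 + 4 * y ^ 2 = 1) {u : ℝ}
    (hu : 2 * y * u = 1 - s) (l : ℕ) :
    HasSum (fun k : ℕ ↦ ((l + 2 * k).choose k : ℝ) * y ^ (l + 2 * k)) (u ^ l / s) := by
  have hyu : y * (1 + u ^ 2) = u := by
    have : 4 * y * (y * (1 + u ^ 2) - u) = 0 := by
      linear_combination (2 * y * u - 1 - s) * hu + hy
    have := (mul_eq_zero.1 this).resolve_left (by simpa using hy0)
    linarith
  induction l using Nat.strong_induction_on with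
  | _ l ih =>
    rcases l with _ | _ | l
    · simpa [Nat.centralBinom] using hasSum_centralBinom hs hy
    · have := ((hasSum_nat_add_iff' 1).2 (hasSum_centralBinom hs hy)).mul_left (1 / (2 * y))
      refine this.of_eq (fun k ↦ ?_) ?_
      · rw [centralBinom_succ_eq_two_mul_choose]
        field_simp
        ring
      · simp
        field_simp
        linear_combination hu
    · have h1 := ih (l + 1) (by omega)
      have h2 := ih l (by omega)
      have := ((hasSum_nat_add_iff' 1).2 (h1.sub (h2.mul_left y))).mul_left (1 / y)
      refine this.of_eq (fun k ↦ ?_) ?_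
      · rw [choose_add_two_mul_succ]
        field_simp
        ring
      · simp
        field_simp
        linear_combination u ^ l * hyu

lemma hasSum_mul_choose (hs : 0 < s) (hy0 : y ≠ 0) (hy : s ^ 2 + 4 * y ^ 2 = 1) {u : ℝ}
    (hu : 2 * y * u = 1 - s) (l : ℕ) :
    HasSum (fun k : ℕ ↦ ((l : ℝ) + k) * ((l + 2 * k).choose k : ℝ) * y ^ (l + 2 * k))
      (u ^ l / 2 * (l * (1 + s) / s ^ 2 + 4 * y ^ 2 / s ^ 3)) := by
  have hyu : y * (1 + u ^ 2) = u := by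
    have : 4 * y * (y * (1 + u ^ 2) - u) = 0 := by
      linear_combination (2 * y * u - 1 - s) * hu + hy
    have := (mul_eq_zero.1 this).resolve_left (by simpa using hy0)
    linarith
  have hu1 : u * (1 + s) = 2 * y := by
    have : 2 * y * (u * (1 + s) - 2 * y) = 0 := by
      linear_combination (1 + s) * hu - hy
    have := (mul_eq_zero.1 this).resolve_left (by simpa using hy0)
    linarith
  have h0 : HasSum (fun k : ℕ ↦ (k : ℝ) * k.centralBinom * y ^ (2 * k))
      (2 * y ^ 2 / s ^ 3) := by
    have := ((hasSum_two_mul_add_one_mul_centralBinom hs hy).sub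
      (hasSum_centralBinom hs hy)).mul_left (1 / 2)
    refine this.of_eq (fun k ↦ ?_) ?_
    · ring
    · field_simp
      linear_combination hy
  induction l using Nat.strong_induction_on with
  | _ l ih =>
    rcases l with _ | _ | l
    · simp only [Nat.cast_zero, zero_add, pow_zero, zero_mul, zero_div]
      refine h0.of_eq (fun k ↦ by simp [Nat.centralBinom]) (by ring)
    · have := ((hasSum_nat_add_iff' 1).2 h0).mul_left (1 / (2 * y))
      refine this.of_eq (fun k ↦ ?_) ?_
      · rw [centralBinom_succ_eq_two_mul_choose]
        push_cast
        field_simp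
        ring
      · simp
        field_simp
        linear_combination u * hy + hu1
    · have h1 := ih (l + 1) (by omega)
      have h2 := ih l (by omega)
      have h3 := hasSum_choose hs hy0 hy hu l
      have := ((hasSum_nat_add_iff' 1).2 (h1.sub ((h2.add h3).mul_left y))).mul_left (1 / y)
      refine this.of_eq (fun k ↦ ?_) ?_
      · rw [choose_add_two_mul_succ]
        push_cast
        field_simp
        ring
      · simp
        field_simp
        linear_combination u ^ l *
          ((l * (1 + s) * s + 4 * y ^ 2) * hyu + s * u * (1 + s) * hu - s ^ 2 * hu1)

end GeneratingFunction

section CoefficientSeries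

/-- The combinatorial sum in the coefficients of the asymptotic expansion. -/
noncomputable def coeffSum (b : ℝ) (n : ℕ) : ℝ :=
  ∑ k ∈ range (n / 2 + 1), (n.choose k : ℝ) * ((n - k : ℕ) : ℝ) / ((n - 2 * k).factorial : ℝ) *
    b ^ (n - 2 * k)

lemma coeffSum_neg (b : ℝ) (n : ℕ) : coeffSum (-b) n = (-1) ^ n * coeffSum b n := by
  rw [coeffSum, coeffSum, mul_sum]
  refine sum_congr rfl fun k hk ↦ ?_
  have hk' : 2 * k ≤ n := by
    have := mem_range.1 hk
    omega
  have : (-1 : ℝ) ^ n = (-1) ^ (n - 2 * k) := by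
    conv_lhs => rw [← Nat.sub_add_cancel hk', pow_add, pow_mul]
    simp
  rw [neg_pow b, this]
  ring

lemma hasSum_pow_div_factorial (z : ℝ) : HasSum (fun l : ℕ ↦ z ^ l / l.factorial) (exp z) := by
  rw [exp_eq_exp_ℝ]
  exact NormedSpace.expSeries_div_hasSum_exp z

lemma hasSum_mul_pow_div_factorial (z : ℝ) :
    HasSum (fun l : ℕ ↦ l * (z ^ l / l.factorial)) (z * exp z) := by
  refine (hasSum_nat_add_iff' 1).1 ?_
  refine ((hasSum_pow_div_factorial z).mul_left z).of_eq (fun l ↦ ?_) (by simp)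
  have : (l.factorial : ℝ) ≠ 0 := by positivity
  have : (l : ℝ) + 1 ≠ 0 := by positivity
  rw [Nat.factorial_succ]
  push_cast
  field_simp
  ring

/-- The summand of the double series behind the generating function of `coeffSum`. -/
noncomputable def doubleTerm (b y : ℝ) (q : ℕ × ℕ) : ℝ :=
  b ^ q.1 / q.1.factorial *
    (((q.1 : ℝ) + q.2) * ((q.1 + 2 * q.2).choose q.2 : ℝ) * y ^ (q.1 + 2 * q.2))

variable {y s u : ℝ}

lemma hasSum_doubleTerm_snd (b : ℝ) (hs : 0 < s) (hy0 : y ≠ 0) (hy : s ^ 2 + 4 * y ^ 2 = 1)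
    (hu : 2 * y * u = 1 - s) (l : ℕ) :
    HasSum (fun k ↦ doubleTerm b y (l, k))
      (b ^ l / l.factorial * (u ^ l / 2 * (l * (1 + s) / s ^ 2 + 4 * y ^ 2 / s ^ 3))) :=
  (hasSum_mul_choose hs hy0 hy hu l).mul_left _

lemma hasSum_doubleTerm_fst (b : ℝ) :
    HasSum (fun l : ℕ ↦ b ^ l / l.factorial *
        (u ^ l / 2 * (l * (1 + s) / s ^ 2 + 4 * y ^ 2 / s ^ 3)))
      (exp (b * u) / 2 * (b * u * (1 + s) / s ^ 2 + 4 * y ^ 2 / s ^ 3)) := by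
  refine (((hasSum_mul_pow_div_factorial (b * u)).mul_left ((1 + s) / s ^ 2 / 2)).add
    ((hasSum_pow_div_factorial (b * u)).mul_left (4 * y ^ 2 / s ^ 3 / 2))).of_eq
    (fun l ↦ ?_) (by ring)
  rw [mul_pow]
  ring

lemma summable_doubleTerm (b : ℝ) (hs : 0 < s) (hy0 : 0 < y) (hy : s ^ 2 + 4 * y ^ 2 = 1)
    (hu : 2 * y * u = 1 - s) : Summable (doubleTerm b y) := by
  have habs : ∀ q, ‖doubleTerm b y q‖ = doubleTerm |b| y q := by
    intro q
    rw [doubleTerm, doubleTerm, norm_mul, norm_div, norm_pow, norm_eq_abs b, Real.norm_natCast,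
      norm_of_nonneg (by positivity)]
  refine Summable.of_norm ?_
  simp only [habs]
  refine (summable_prod_of_nonneg fun q ↦ ?_).2 ⟨fun l ↦ ?_, ?_⟩
  · simp only [doubleTerm, Pi.zero_apply]
    positivity
  · exact (hasSum_doubleTerm_snd _ hs hy0.ne' hy hu l).summable
  · simp only [(hasSum_doubleTerm_snd _ hs hy0.ne' hy hu _).tsum_eq]
    exact (hasSum_doubleTerm_fst _).summable

lemma hasSum_coeffSum_mul_pow (b : ℝ) (hs : 0 < s) (hy0 : 0 < y) (hy : s ^ 2 + 4 * y ^ 2 = 1)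
    (hu : 2 * y * u = 1 - s) :
    HasSum (fun n ↦ coeffSum b n * y ^ n)
      (exp (b * u) / 2 * (b * u * (1 + s) / s ^ 2 + 4 * y ^ 2 / s ^ 3)) := by
  have hsum := (summable_doubleTerm b hs hy0 hy hu).hasSum
  have hval := (hsum.prod_fiberwise (hasSum_doubleTerm_snd b hs hy0.ne' hy hu)).unique
    (hasSum_doubleTerm_fst b)
  rw [hval] at hsum
  let g : ℕ × ℕ → ℕ × ℕ := fun q ↦ (q.1 + 2 * q.2, q.2)
  let T : ℕ × ℕ → ℝ := fun q ↦ if 2 * q.2 ≤ q.1 then doubleTerm b y (q.1 - 2 * q.2, q.2) else 0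
  have hg : Function.Injective g := by
    rintro ⟨a, b⟩ ⟨a', b'⟩ h
    simp only [g, Prod.mk.injEq] at h ⊢
    omega
  have hT : ∀ q ∉ Set.range g, T q = 0 := by
    rintro ⟨n, k⟩ hq
    refine if_neg fun hle ↦ hq ⟨(n - 2 * k, k), ?_⟩
    simp only [g, Prod.mk.injEq, and_true]
    exact Nat.sub_add_cancel hle
  have hTg : T ∘ g = doubleTerm b y := by
    ext q
    simp [T, g]
  have hTsum : HasSum T (exp (b * u) / 2 * (b * u * (1 + s) / s ^ 2 + 4 * y ^ 2 / s ^ 3)) := by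
    rw [← hg.hasSum_iff hT, hTg]
    exact hsum
  refine hTsum.prod_fiberwise fun n ↦ ?_
  have hfib : coeffSum b n * y ^ n = ∑ k ∈ range (n / 2 + 1), T (n, k) := by
    rw [coeffSum, sum_mul]
    refine sum_congr rfl fun k hk ↦ ?_
    have hk' : 2 * k ≤ n := by
      have := mem_range.1 hk
      omega
    obtain ⟨l, rfl⟩ := Nat.exists_eq_add_of_le' hk'
    have h1 : l + 2 * k - k = l + k := by omega
    simp only [T, doubleTerm, hk', if_true, Nat.add_sub_cancel, h1]
    push_cast
    ring
  rw [hfib]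
  refine hasSum_sum_of_ne_finset_zero fun k hk ↦ if_neg fun hle ↦ hk (mem_range.2 ?_)
  simp only at hle
  omega

lemma coeffSum_zero_right (b : ℝ) : coeffSum b 0 = 0 := by
  simp [coeffSum]

lemma hasSum_neg_one_pow_mul_coeffSum {b : ℝ} (hb : b ≠ 0) (hs : 0 < s) (hy0 : 0 < y)
    (hy : s ^ 2 + 4 * y ^ 2 = 1) (hu : 2 * y * u = 1 - s) :
    HasSum (fun m : ℕ ↦ (-1) ^ m * (coeffSum b (m + 1) / b * y ^ m))
      (exp (-(b * u)) * (1 / s ^ 2 - 2 * y / (b * s ^ 3))) := by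
  have hu1 : u * (1 + s) = 2 * y := by
    have : 2 * y * (u * (1 + s) - 2 * y) = 0 := by
      linear_combination (1 + s) * hu - hy
    have := (mul_eq_zero.1 this).resolve_left (by positivity)
    linarith
  have := ((hasSum_nat_add_iff' 1).2
    (hasSum_coeffSum_mul_pow (-b) hs hy0 hy hu)).mul_left (-(1 / (b * y)))
  refine this.of_eq (fun m ↦ ?_) ?_
  · rw [coeffSum_neg]
    have := hy0.ne'
    field_simp
    ring
  · have := hy0.ne'
    simp only [range_one, sum_singleton, coeffSum_zero_right, zero_mul, sub_zero]
    rw [neg_mul]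
    field_simp
    linear_combination (-(b * s)) * hu1

end CoefficientSeries

section Expansion

lemma c_div_rpow {n : ℕ} (hn : 1 ≤ n) (m : ℕ) :
    c m / (n : ℝ) ^ ((m : ℝ) / 2) =
      (-1) ^ m * (coeffSum (π / 6) (m + 1) / (π / 6) * (1 / (2 * √(24 * n))) ^ m) := by
  have hn0 : (0 : ℝ) < n := by exact_mod_cast hn
  have hb : π / 6 ≠ 0 := by positivity
  have h1 : (n : ℝ) ^ ((m : ℝ) / 2) = √n ^ m := by
    rw [sqrt_eq_rpow, ← rpow_natCast, ← rpow_mul hn0.le]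
    ring_nf
  have h2 : 2 * √(24 * (n : ℝ)) = 4 * √6 * √n := by
    rw [show (24 * n : ℝ) = 2 ^ 2 * 6 * n by ring, sqrt_mul (by positivity),
      sqrt_mul (by positivity), sqrt_sq (by positivity)]
    ring
  have h3 : ∑ k ∈ range ((m + 1) / 2 + 1),
      ((m + 1).choose k : ℝ) * ((m + 1 - k : ℕ) : ℝ) / ((m + 1 - 2 * k).factorial : ℝ) *
        (π / 6) ^ ((m : ℤ) - 2 * k) = coeffSum (π / 6) (m + 1) / (π / 6) := by
    rw [coeffSum, sum_div]
    refine sum_congr rfl fun k hk ↦ ?_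
    have hk' : 2 * k ≤ m + 1 := by
      have := mem_range.1 hk
      omega
    rw [show (m : ℤ) - 2 * k = ((m + 1 - 2 * k : ℕ) : ℤ) - 1 by push_cast [hk']; ring,
      zpow_sub_one₀ hb, zpow_natCast]
    ring
  rw [c, h3, h1, h2, div_pow, mul_pow, one_pow]
  have : √6 ≠ 0 := by positivity
  have : √(n : ℝ) ≠ 0 := by positivity
  field_simp
  ring

lemma sqrt_two_mul_div_three (n : ℕ) : √(2 * n / 3) = √(24 * (n : ℝ)) / 6 := by
  rw [show (2 * n / 3 : ℝ) = 24 * n / 6 ^ 2 by ring, sqrt_div (by positivity),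
    sqrt_sq (by positivity)]

lemma hasSum_c_div_rpow {n : ℕ} (hn : 1 ≤ n) :
    HasSum (fun m : ℕ ↦ c m / (n : ℝ) ^ ((m : ℝ) / 2))
      (4 * √3 * n * exp (-(π * √(2 * n / 3))) * mainTerm n) := by
  have hn1 : (1 : ℝ) ≤ n := by exact_mod_cast hn
  set L := √(24 * (n : ℝ)) with hL
  set v := √(24 * (n : ℝ) - 1) with hv
  have hL0 : 0 < L := sqrt_pos.2 (by linarith)
  have hv0 : 0 < v := sqrt_pos.2 (by linarith)
  have hL2 : L ^ 2 = 24 * n := sq_sqrt (by linarith)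
  have hv2 : v ^ 2 = 24 * n - 1 := sq_sqrt (by linarith)
  have hb : π / 6 ≠ 0 := by positivity
  have hsum := hasSum_neg_one_pow_mul_coeffSum (y := 1 / (2 * L)) (s := v / L) (u := L - v) hb
    (by positivity) (by positivity) (by field_simp; linarith) (by field_simp)
  refine hsum.of_eq (fun m ↦ c_div_rpow hn m) ?_
  have h3 : √12 = 2 * √3 := by
    rw [show (12 : ℝ) = 2 ^ 2 * 3 by norm_num, sqrt_mul (by positivity), sqrt_sq (by positivity)]
  have h33 : √3 * √3 = 3 := mul_self_sqrt (by norm_num)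
  have hexp : exp (-(π / 6 * (L - v))) = exp (-(π * (L / 6))) * exp (π * v / 6) := by
    rw [← exp_add]
    ring_nf
  rw [sqrt_two_mul_div_three, mainTerm, hexp, ← hL, ← hv, ← hv2, h3]
  have hnn : (n : ℝ) = L ^ 2 / 24 := by linarith
  rw [hnn]
  have hpi := pi_pos.ne'
  field_simp
  linear_combination (8 : ℝ) * (π * v - 6) * h33

end Expansion

section CoefficientBounds

variable {b : ℝ}

lemma coeffSum_nonneg (hb : 0 ≤ b) (n : ℕ) : 0 ≤ coeffSum b n :=
  sum_nonneg fun _ _ ↦ by positivity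

lemma coeffSum_term_succ_le (hb : 0 ≤ b) {l k : ℕ} (h : 1 ≤ l + k) :
    ((l + 2 * k + 1).choose k : ℝ) * ((l + k + 1 : ℕ) : ℝ) / ((l + 1).factorial : ℝ) * b ^ (l + 1) ≤
      3 * b * (((l + 2 * k).choose k : ℝ) * ((l + k : ℕ) : ℝ) / (l.factorial : ℝ) * b ^ l) := by
  have h1 : ((l + 2 * k).choose k : ℝ) * (l + 2 * k + 1) =
      ((l + 2 * k + 1).choose k : ℝ) * ((l + k + 1 : ℕ) : ℝ) := by
    have := Nat.choose_mul_succ_eq (l + 2 * k) k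
    rw [show l + 2 * k + 1 - k = l + k + 1 by omega] at this
    exact_mod_cast this
  have h2 : (l : ℝ) + 2 * k + 1 ≤ 3 * (l + k) * (l + 1) := by
    have hr : (1 : ℝ) ≤ l + k := by exact_mod_cast h
    have hl : (0 : ℝ) ≤ l := by positivity
    have hk : (0 : ℝ) ≤ k := by positivity
    nlinarith
  rw [← h1, Nat.factorial_succ]
  push_cast
  have hf : (0 : ℝ) < l.factorial := by positivity
  rw [show ((l + 2 * k).choose k : ℝ) * (l + 2 * k + 1) / ((l + 1) * l.factorial) * b ^ (l + 1) =
      ((l + 2 * k).choose k : ℝ) / l.factorial * b ^ (l + 1) * ((l + 2 * k + 1) / (l + 1)) by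
        field_simp,
    show 3 * b * (((l + 2 * k).choose k : ℝ) * (l + k) / (l.factorial : ℝ) * b ^ l) =
      ((l + 2 * k).choose k : ℝ) / l.factorial * b ^ (l + 1) * (3 * (l + k)) by ring]
  refine mul_le_mul_of_nonneg_left ?_ (by positivity)
  rwa [div_le_iff₀ (by positivity)]

lemma sum_coeffSum_term_succ_le (hb : 0 ≤ b) {n : ℕ} (hn : 1 ≤ n) :
    ∑ k ∈ range (n / 2 + 1), ((n + 1).choose k : ℝ) * ((n + 1 - k : ℕ) : ℝ) /
        ((n + 1 - 2 * k).factorial : ℝ) * b ^ (n + 1 - 2 * k) ≤ 3 * b * coeffSum b n := by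
  rw [coeffSum, mul_sum]
  refine sum_le_sum fun k hk ↦ ?_
  have hk' : 2 * k ≤ n := by
    have := mem_range.1 hk
    omega
  obtain ⟨l, rfl⟩ := Nat.exists_eq_add_of_le' hk'
  have := coeffSum_term_succ_le hb (l := l) (k := k) (by omega)
  rwa [show l + 2 * k + 1 - k = l + k + 1 by omega,
    show l + 2 * k + 1 - 2 * k = l + 1 by omega, show l + 2 * k - k = l + k by omega,
    show l + 2 * k - 2 * k = l by omega]

lemma coeffSum_succ_le (hb : 0 < b) {n : ℕ} (hn : 1 ≤ n) :
    coeffSum b (n + 1) ≤ (3 * b + 2 / b) * coeffSum b n := by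
  have hmain := sum_coeffSum_term_succ_le hb.le hn
  have hpos : 0 ≤ 2 / b * coeffSum b n := mul_nonneg (by positivity) (coeffSum_nonneg hb.le n)
  rcases Nat.even_or_odd' n with ⟨j, rfl | rfl⟩
  · have : (2 * j + 1) / 2 = 2 * j / 2 := by omega
    rw [coeffSum, this]
    linarith
  · have h1 : (2 * j + 1 + 1) / 2 = (2 * j + 1) / 2 + 1 := by omega
    have h2 : (2 * j + 1) / 2 = j := by omega
    rw [coeffSum, h1, sum_range_succ, h2]
    rw [h2] at hmain
    have hterm : ((2 * j + 1).choose j : ℝ) * ((2 * j + 1 - j : ℕ) : ℝ) /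
        ((2 * j + 1 - 2 * j).factorial : ℝ) * b ^ (2 * j + 1 - 2 * j) ≤ coeffSum b (2 * j + 1) := by
      rw [coeffSum, h2]
      exact single_le_sum (f := fun k ↦ ((2 * j + 1).choose k : ℝ) * ((2 * j + 1 - k : ℕ) : ℝ) /
        ((2 * j + 1 - 2 * k).factorial : ℝ) * b ^ (2 * j + 1 - 2 * k))
        (fun _ _ ↦ by positivity) (mem_range.2 (Nat.lt_succ_self j))
    have h3 : 2 * j + 1 - j = j + 1 := by omega
    have h4 : 2 * j + 1 + 1 - (j + 1) = j + 1 := by omega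
    have h5 : 2 * j + 1 - 2 * j = 1 := by omega
    have h6 : 2 * j + 1 + 1 - 2 * (j + 1) = 0 := by omega
    have h7 := centralBinom_succ_eq_two_mul_choose j
    rw [Nat.centralBinom, show 2 * (j + 1) = 2 * j + 1 + 1 by ring, add_comm 1] at h7
    rw [h3, h5, Nat.factorial_one, Nat.cast_one, div_one, pow_one] at hterm
    rw [h4, h6, h7, Nat.factorial_zero, Nat.cast_one, div_one, pow_zero, mul_one]
    have := mul_le_mul_of_nonneg_left hterm (show 0 ≤ 2 / b by positivity)
    rw [show 2 / b * (((2 * j + 1).choose j : ℝ) * ((j + 1 : ℕ) : ℝ) * b) =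
      2 * ((2 * j + 1).choose j : ℝ) * ((j + 1 : ℕ) : ℝ) by field_simp] at this
    linarith

lemma antitone_coeffSum_mul_pow (hb : 0 < b) {y : ℝ} (hy0 : 0 ≤ y) (hy : (3 * b + 2 / b) * y ≤ 1) :
    Antitone fun m : ℕ ↦ coeffSum b (m + 1) / b * y ^ m := by
  refine antitone_nat_of_succ_le fun m ↦ ?_
  have hA := coeffSum_nonneg hb.le (m + 1)
  calc coeffSum b (m + 1 + 1) / b * y ^ (m + 1)
      ≤ ((3 * b + 2 / b) * coeffSum b (m + 1)) / b * y ^ (m + 1) := by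
        gcongr
        exact coeffSum_succ_le hb (Nat.le_add_left 1 m)
    _ = ((3 * b + 2 / b) * y) * (coeffSum b (m + 1) / b * y ^ m) := by ring
    _ ≤ 1 * (coeffSum b (m + 1) / b * y ^ m) := by gcongr
    _ = coeffSum b (m + 1) / b * y ^ m := one_mul _

lemma coeffSum_two_mul_succ_le (hb : 0 ≤ b) (j : ℕ) :
    coeffSum b (2 * (j + 1)) ≤ (j + 1) * (j + 1).centralBinom * cosh b := by
  have hterm : ∀ k ∈ range (j + 1 + 1), ((2 * (j + 1)).choose k : ℝ) *
      ((2 * (j + 1) - k : ℕ) : ℝ) ≤ (j + 1) * (j + 1).centralBinom := by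
    intro k hk
    have h1 := Nat.choose_mul_succ_eq (2 * j + 1) k
    have h2 := Nat.choose_le_middle k (2 * j + 1)
    rw [show (2 * j + 1) / 2 = j by omega] at h2
    rw [centralBinom_succ_eq_two_mul_choose, add_comm 1, show 2 * (j + 1) = 2 * j + 1 + 1 by ring]
    have h3 : (2 * j + 1 + 1).choose k * (2 * j + 1 + 1 - k) ≤
        (j + 1) * (2 * (2 * j + 1).choose j) := by
      rw [← h1]
      nlinarith only [h2]
    exact_mod_cast h3
  have hsum : ∑ k ∈ range (j + 1 + 1), b ^ (2 * k) / ((2 * k).factorial : ℝ) ≤ cosh b :=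
    sum_le_hasSum _ (fun k _ ↦ by positivity) (hasSum_cosh b)
  rw [← sum_range_reflect] at hsum
  have hcb : (0 : ℝ) ≤ (j + 1) * (j + 1).centralBinom := by positivity
  refine le_trans ?_ (mul_le_mul_of_nonneg_left hsum hcb)
  rw [coeffSum, show 2 * (j + 1) / 2 = j + 1 by omega, mul_sum]
  refine sum_le_sum fun k hk ↦ ?_
  have hk' := mem_range.1 hk
  rw [show 2 * (j + 1 + 1 - 1 - k) = 2 * (j + 1) - 2 * k by omega, div_mul_eq_mul_div,
    mul_div_assoc]
  exact mul_le_mul_of_nonneg_right (hterm k hk) (by positivity)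

lemma monotone_sq_centralBinom_div_mul :
    Monotone fun n : ℕ ↦ ((n.centralBinom : ℝ) / 4 ^ n) ^ 2 * (n + 1 / 4) := by
  refine monotone_nat_of_le_succ fun n ↦ ?_
  rw [centralBinom_succ_real]
  have hn : (0 : ℝ) ≤ n := by positivity
  have h4 : (n.centralBinom * (2 * (2 * n + 1)) / (n + 1) / 4 ^ (n + 1) : ℝ) =
      n.centralBinom / 4 ^ n * ((2 * n + 1) / (2 * n + 2)) := by
    field_simp
    ring
  rw [h4, mul_pow, mul_assoc]
  refine mul_le_mul_of_nonneg_left ?_ (by positivity)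
  push_cast
  rw [div_pow, div_mul_eq_mul_div, le_div_iff₀ (by positivity)]
  nlinarith only

lemma tendsto_sq_centralBinom_div_mul :
    Tendsto (fun n : ℕ ↦ ((n.centralBinom : ℝ) / 4 ^ n) ^ 2 * (n + 1 / 4)) atTop (𝓝 (1 / π)) := by
  have h1 : Tendsto (fun n : ℕ ↦ 1 / 2 - 1 / 4 * (1 / ((2 * n + 1 : ℕ) : ℝ))) atTop
      (𝓝 (1 / 2 - 1 / 4 * 0)) := by
    refine tendsto_const_nhds.sub (Tendsto.const_mul _ ?_)
    refine (tendsto_const_div_atTop_nhds_zero_nat 1).comp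
      (tendsto_atTop_mono (fun n : ℕ ↦ ?_) tendsto_id)
    simp only [id]
    omega
  have h2 := h1.div Wallis.tendsto_W_nhds_pi_div_two (by positivity)
  rw [show (1 / 2 - 1 / 4 * 0) / (π / 2) = 1 / π by field_simp; norm_num] at h2
  refine h2.congr fun n ↦ ?_
  have hf : (n.factorial : ℝ) ≠ 0 := by positivity
  have hf2 : ((2 * n).factorial : ℝ) ≠ 0 := by positivity
  have hcb : (n.centralBinom : ℝ) = (2 * n).factorial / (n.factorial * n.factorial) := by
    rw [Nat.centralBinom, Nat.cast_choose ℝ (by omega), show 2 * n - n = n by omega]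
  simp only [Pi.div_apply]
  rw [Wallis.W_eq_factorial_ratio, hcb, pow_mul]
  have h2n : (2 * (n : ℝ) + 1) ≠ 0 := by positivity
  have h16 : ((2 : ℝ) ^ 4) ^ n = 4 ^ n * 4 ^ n := by rw [← mul_pow]; norm_num
  rw [h16]
  push_cast
  field_simp
  ring

lemma centralBinom_div_four_pow_le (n : ℕ) :
    (n.centralBinom : ℝ) / 4 ^ n ≤ 1 / √(π * (n + 1 / 4)) := by
  have h := monotone_sq_centralBinom_div_mul.ge_of_tendsto tendsto_sq_centralBinom_div_mul n
  have hn : (0 : ℝ) < n + 1 / 4 := by positivity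
  rw [show 1 / √(π * (n + 1 / 4)) = √(1 / (π * (n + 1 / 4))) by rw [sqrt_div zero_le_one, sqrt_one]]
  refine le_sqrt_of_sq_le ?_
  rw [← div_div, le_div_iff₀ hn]
  exact h

end CoefficientBounds

section Remainder

lemma coeffSum_div_mul_pow_le (N : ℕ) {L : ℝ} (hL : 0 < L) :
    coeffSum (π / 6) (2 * N + 1 + 1) / (π / 6) * (1 / (2 * L)) ^ (2 * N + 1) ≤
      6 * √2 / π ^ ((3 : ℝ) / 2) * cosh (π / 6) * √(1 - 1 / (4 * N + 5)) * √(2 * N + 2) /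
        L ^ (2 * N + 1) := by
  have hpi := pi_pos
  have hpi0 := pi_pos.ne'
  have hcosh := cosh_pos (π / 6)
  have h1 := coeffSum_two_mul_succ_le (b := π / 6) (by positivity) N
  have h2 := centralBinom_div_four_pow_le (N + 1)
  have hsq : √2 * √(1 - 1 / (4 * N + 5)) * √(2 * N + 2) = 4 * (N + 1) / √(4 * N + 5) := by
    rw [← sqrt_mul (by positivity), ← sqrt_mul' _ (by positivity),
      show (2 * (1 - 1 / (4 * N + 5)) * (2 * N + 2) : ℝ) = (4 * (N + 1)) ^ 2 / (4 * N + 5) by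
        field_simp; ring,
      sqrt_div (by positivity), sqrt_sq (by positivity)]
  have hsq2 : √(π * ((N + 1 : ℕ) + 1 / 4)) = √π * √(4 * N + 5) / 2 := by
    rw [show π * (((N + 1 : ℕ) : ℝ) + 1 / 4) = π * (4 * N + 5) / 2 ^ 2 by push_cast; ring,
      sqrt_div (by positivity), sqrt_sq (by positivity), sqrt_mul (by positivity)]
  have hrp : π ^ ((3 : ℝ) / 2) = π * √π := by
    rw [sqrt_eq_rpow, show (3 : ℝ) / 2 = 1 + 1 / 2 by norm_num, rpow_add hpi, rpow_one]
  have h4 : (1 / (2 * L)) ^ (2 * N + 1) = 2 / 4 ^ (N + 1) / L ^ (2 * N + 1) := by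
    have : (2 : ℝ) ^ (2 * N) = 4 ^ N := by rw [pow_mul]; norm_num
    rw [div_pow, mul_pow, one_pow, pow_succ (2 : ℝ), this, pow_succ (4 : ℝ)]
    field_simp
    norm_num
  rw [hsq2] at h2
  calc coeffSum (π / 6) (2 * N + 1 + 1) / (π / 6) * (1 / (2 * L)) ^ (2 * N + 1)
      ≤ ((N + 1) * (N + 1).centralBinom * cosh (π / 6)) / (π / 6) *
          (1 / (2 * L)) ^ (2 * N + 1) := by
        gcongr
        exact h1
    _ = 12 / π * (N + 1) * cosh (π / 6) / L ^ (2 * N + 1) *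
          ((N + 1).centralBinom / 4 ^ (N + 1)) := by
        rw [h4]
        field_simp
        ring
    _ ≤ 12 / π * (N + 1) * cosh (π / 6) / L ^ (2 * N + 1) * (1 / (√π * √(4 * N + 5) / 2)) := by
        gcongr
    _ = 6 / (π * √π) * cosh (π / 6) * (4 * (N + 1) / √(4 * N + 5)) / L ^ (2 * N + 1) := by
        field_simp
        ring
    _ = _ := by
        rw [hrp, ← hsq]
        ring

lemma abs_exp_mul_p_sub_mainTerm_lt {n : ℕ} (hn : 1 ≤ n) :
    |4 * √3 * n * exp (-(π * √(2 * n / 3))) * (p n - mainTerm n)| <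
      exp (-(π / 2 * √(2 * n / 3))) := by
  have hn0 : (0 : ℝ) < n := by exact_mod_cast hn
  have h3 : √12 = 2 * √3 := by
    rw [show (12 : ℝ) = 2 ^ 2 * 3 by norm_num, sqrt_mul (by positivity), sqrt_sq (by positivity)]
  have h33 : √3 * √3 = 3 := mul_self_sqrt (by norm_num)
  rw [abs_mul, abs_of_pos (by positivity), sqrt_two_mul_div_three]
  calc 4 * √3 * n * exp (-(π * (√(24 * n) / 6))) * |p n - mainTerm n|
      < 4 * √3 * n * exp (-(π * (√(24 * n) / 6))) *
          (√12 / (24 * n) * exp (π * √(24 * n - 1) / 12)) := by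
        gcongr
        exact abs_p_sub_mainTerm_lt hn
    _ ≤ 4 * √3 * n * exp (-(π * (√(24 * n) / 6))) *
          (√12 / (24 * n) * exp (π * √(24 * n) / 12)) := by
        gcongr
        linarith
    _ = exp (-(π * (√(24 * n) / 6))) * exp (π * √(24 * n) / 12) := by
        rw [h3]
        field_simp
        linear_combination (8 : ℝ) * h33
    _ = exp (-(π / 2 * (√(24 * n) / 6))) := by
        rw [← exp_add]
        ring_nf

lemma three_mul_add_two_div_mul_le {n : ℕ} (hn : 1 ≤ n) :
    (3 * (π / 6) + 2 / (π / 6)) * (1 / (2 * √(24 * n))) ≤ 1 := by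
  have hn1 : (1 : ℝ) ≤ n := by exact_mod_cast hn
  have hL : 4 ≤ √(24 * (n : ℝ)) := le_sqrt_of_sq_le (by linarith)
  have h1 : 3 * (π / 6) + 2 / (π / 6) ≤ 8 := by
    rw [← le_sub_iff_add_le', div_le_iff₀ (by positivity)]
    nlinarith only [pi_gt_d2, pi_lt_d2]
  rw [mul_one_div, div_le_one (by positivity)]
  linarith

lemma remainder_bounds (N : ℕ) {n : ℕ} (hn : 1 ≤ n) :
    -(6 * √2 / π ^ ((3 : ℝ) / 2) * cosh (π / 6) * √(1 - 1 / (4 * N + 5)) * √(2 * N + 2) /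
        √(24 * n) ^ (2 * N + 1)) - exp (-(π / 2 * √(2 * n / 3))) < R (2 * N + 1) n ∧
      R (2 * N + 1) n < exp (-(π / 2 * √(2 * n / 3))) := by
  have hL : 0 < √(24 * (n : ℝ)) := by positivity
  have hE := abs_lt.1 (abs_exp_mul_p_sub_mainTerm_lt hn)
  have hanti := antitone_coeffSum_mul_pow (b := π / 6) (by positivity) (by positivity)
    (three_mul_add_two_div_mul_le hn)
  have hsum := (hasSum_c_div_rpow hn).tendsto_sum_nat
  simp only [c_div_rpow hn] at hsum
  have hup := hanti.tendsto_le_alternating_series hsum N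
  have hlow := hanti.alternating_series_le_tendsto hsum (N + 1)
  rw [show 2 * (N + 1) = 2 * N + 1 + 1 by ring, sum_range_succ, pow_succ, pow_mul] at hlow
  have ha := coeffSum_div_mul_pow_le N hL
  rw [R]
  simp only [c_div_rpow hn]
  rw [mul_sub] at hE
  norm_num only [one_pow] at hlow
  constructor <;> linarith

end Remainder

end PartitionAsymptotics


theorem stmt14 (C : ℝ) (hC : 0 < C) (N n : ℕ) (hn : 1 ≤ n)
    (h : Real.exp (-(π / 2 * Real.sqrt (2 * n / 3))) ≤
      C * Real.sqrt (2 * N + 2) / Real.sqrt (24 * n) ^ (2 * N + 1)) :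
    -((C + 6 * Real.sqrt 2 / π ^ ((3 : ℝ) / 2) * Real.cosh (π / 6) *
            Real.sqrt (1 - 1 / (4 * N + 5))) *
          Real.sqrt (2 * N + 2) / Real.sqrt (24 * n) ^ (2 * N + 1)) < R (2 * N + 1) n ∧
      R (2 * N + 1) n < C * Real.sqrt (2 * N + 2) / Real.sqrt (24 * n) ^ (2 * N + 1) := by
  obtain ⟨hlow, hup⟩ := PartitionAsymptotics.remainder_bounds N hn
  refine ⟨?_, hup.trans_le h⟩
  rw [add_mul, add_div]
  linarith
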